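/- Let b be a rational function in the closed unit ball of H∞ with ‖b‖∞ = 1 that is not a finite Blaschke product. Let φ ∈ H(b) ∩ ball(H∞) with φ(ξ_j) ∈ Z_T(a) for 1 ≤ j ≤ p and φ(ξ_j) ∈ D for p+1 ≤ j ≤ n, and let u = (a₁ ∘ φ) · ∏_{j=p+1}^n (φ − φ(ξ_j))^{m_j} / a₁. Then the composition operator C_φ : H(b) → H(b) is bounded if and only if the weighted composition operator W_{u,φ} : H² → H², W_{u,φ}(f) = u·(f ∘ φ), is bounded. -/

import Mathlib

open Complex MeasureTheory Set Filter

noncomputable section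

attribute [local instance] Classical.propDecidable

/-- The open unit disk in `ℂ`. -/
def unitDisk : Set ℂ := Metric.ball 0 1

/-- The unit circle in `ℂ`. -/
def unitCircle : Set ℂ := Metric.sphere 0 1

/-- Membership in `H^∞`: analytic and bounded on the unit disk. -/
def MemHinf (f : ℂ → ℂ) : Prop :=
  DifferentiableOn ℂ f unitDisk ∧ ∃ C : ℝ, ∀ z ∈ unitDisk, ‖f z‖ ≤ C

/-- Membership in the closed unit ball of `H^∞`. -/
def MemBallHinf (f : ℂ → ℂ) : Prop :=
  DifferentiableOn ℂ f unitDisk ∧ ∀ z ∈ unitDisk, ‖f z‖ ≤ 1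

/-- `f` agrees on the closed unit disk with a rational function without poles there. -/
def IsRationalOnDisk (f : ℂ → ℂ) : Prop :=
  ∃ P Q : Polynomial ℂ, ∀ z ∈ Metric.closedBall (0:ℂ) 1,
    Q.eval z ≠ 0 ∧ f z = P.eval z / Q.eval z

/-- `f` is a finite Blaschke product (multiplicities are encoded by repetition). -/
def IsFiniteBlaschke (f : ℂ → ℂ) : Prop :=
  ∃ (γ : ℂ) (k : ℕ) (lam : Fin k → ℂ), ‖γ‖ = 1 ∧ (∀ i, lam i ∈ unitDisk) ∧
    ∀ z ∈ unitDisk, f z = γ * ∏ i, (z - lam i) / (1 - (starRingEnd ℂ) (lam i) * z)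

/-- The `k`-th Taylor coefficient of `f` at the origin. -/
def taylorCoeff (f : ℂ → ℂ) (k : ℕ) : ℂ := iteratedDeriv k f 0 / k.factorial

/-- Membership in the Hardy space `H²` (square-summable Taylor coefficients). -/
def MemH2 (f : ℂ → ℂ) : Prop :=
  DifferentiableOn ℂ f unitDisk ∧ Summable fun k => ‖taylorCoeff f k‖ ^ 2

/-- The squared `H²` norm. -/
def h2NormSq (f : ℂ → ℂ) : ℝ := ∑' k, ‖taylorCoeff f k‖ ^ 2

/-- The `H²` inner product. -/
def h2Inner (f g : ℂ → ℂ) : ℂ :=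
  ∑' k, (starRingEnd ℂ) (taylorCoeff f k) * taylorCoeff g k

/-- The polynomial `a₁(z) = ∏ⱼ (z − ξⱼ)^{mⱼ}`. -/
def a1fun {n : ℕ} (ξ : Fin n → ℂ) (m : Fin n → ℕ) : ℂ → ℂ :=
  fun z => ∏ j, (z - ξ j) ^ (m j)

/-- A decomposition `f = a₁ g + q` with `g ∈ H²`, `deg q ≤ N − 1`, witnessing membership
in `H(b) = a₁H² ⊕ P_{N−1}`. -/
def HbDecompOf {n : ℕ} (ξ : Fin n → ℂ) (m : Fin n → ℕ)
    (f g : ℂ → ℂ) (q : Polynomial ℂ) : Prop :=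
  MemH2 g ∧ q.degree < ((∑ j, m j : ℕ) : WithBot ℕ) ∧
    ∀ z ∈ unitDisk, f z = a1fun ξ m z * g z + q.eval z

/-- Membership in `H(b) = a₁ H² ⊕ P_{N−1}` (description of `H(b)` for `b` rational,
not a finite Blaschke product, whose pythagorean mate has boundary zeros `ξ` with
multiplicities `m`). -/
def MemHb {n : ℕ} (ξ : Fin n → ℂ) (m : Fin n → ℕ) (f : ℂ → ℂ) : Prop :=
  ∃ gq : (ℂ → ℂ) × Polynomial ℂ, HbDecompOf ξ m f gq.1 gq.2

/-- The (unique) decomposition of a member of `H(b)`. -/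
def hbDecomp {n : ℕ} (ξ : Fin n → ℂ) (m : Fin n → ℕ) (f : ℂ → ℂ) :
    (ℂ → ℂ) × Polynomial ℂ :=
  if h : MemHb ξ m f then h.choose else (0, 0)

/-- The squared norm `⦀a₁g + q⦀² = ‖g‖²_{H²} + ‖q‖²_{H²}` on `H(b)`. -/
def hbNormSq {n : ℕ} (ξ : Fin n → ℂ) (m : Fin n → ℕ) (f : ℂ → ℂ) : ℝ :=
  h2NormSq (hbDecomp ξ m f).1 + h2NormSq fun z => ((hbDecomp ξ m f).2).eval z

/-- The inner product on `H(b)` induced by the decomposition. -/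
def hbInner {n : ℕ} (ξ : Fin n → ℂ) (m : Fin n → ℕ) (f g : ℂ → ℂ) : ℂ :=
  h2Inner (hbDecomp ξ m f).1 (hbDecomp ξ m g).1 +
    h2Inner (fun z => ((hbDecomp ξ m f).2).eval z)
      (fun z => ((hbDecomp ξ m g).2).eval z)

/-- The Stolz angle (non-tangential approach region) at a boundary point `ξ`. -/
def stolzAngle (ξ : ℂ) (M : ℝ) : Set ℂ := {z ∈ unitDisk | ‖z - ξ‖ ≤ M * (1 - ‖z‖)}

/-- `f` has non-tangential limit `L` at `ξ`. -/
def NTLimit (f : ℂ → ℂ) (ξ L : ℂ) : Prop :=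
  ∀ M : ℝ, 1 < M → Tendsto f (nhdsWithin ξ (stolzAngle ξ M)) (nhds L)

/-- Radial boundary value of `f` at `ζ` (junk value if the radial limit does not exist). -/
def bdryVal (f : ℂ → ℂ) (ζ : ℂ) : ℂ :=
  limUnder (nhdsWithin (1:ℝ) (Set.Iio 1)) fun r : ℝ => f ((r : ℂ) * ζ)

/-- The full setting: `b` is a rational function in the closed unit ball of `H^∞` with
`‖b‖_∞ = 1` which is not a finite Blaschke product; `a` is its pythagorean mate (rational,
outer — i.e. zero-free on the disk —, `a(0) > 0`, `|a|² + |b|² = 1` on the circle); the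
`ξ j` are the distinct zeros of `a` on the unit circle, with multiplicities `m j`. -/
structure RationalSetting (b a : ℂ → ℂ) (n : ℕ) (ξ : Fin n → ℂ) (m : Fin n → ℕ) :
    Prop where
  b_diff : DifferentiableOn ℂ b unitDisk
  b_rat : IsRationalOnDisk b
  b_le_one : ∀ z ∈ unitDisk, ‖b z‖ ≤ 1
  b_norm_one : sSup ((fun z => ‖b z‖) '' unitDisk) = 1
  b_not_fbp : ¬ IsFiniteBlaschke b
  a_diff : DifferentiableOn ℂ a unitDisk
  a_rat : IsRationalOnDisk a
  a_outer : ∀ z ∈ unitDisk, a z ≠ 0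
  a_zero_pos : 0 < (a 0).re ∧ (a 0).im = 0
  pyth : ∀ ζ ∈ unitCircle, ‖a ζ‖ ^ 2 + ‖b ζ‖ ^ 2 = 1
  zeros_mem : ∀ j, ξ j ∈ unitCircle
  zeros_inj : Function.Injective ξ
  mult_pos : ∀ j, 0 < m j
  factor : ∃ g : ℂ → ℂ, IsRationalOnDisk g ∧ (∀ ζ ∈ unitCircle, g ζ ≠ 0) ∧
    ∀ z ∈ Metric.closedBall (0:ℂ) 1, a z = a1fun ξ m z * g z

/-- The composition operator `C_φ` maps `H(b)` into itself and is bounded there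
(with respect to the equivalent norm `⦀·⦀_b`). -/
def CompBddHb {n : ℕ} (ξ : Fin n → ℂ) (m : Fin n → ℕ) (φ : ℂ → ℂ) : Prop :=
  (∀ f, MemHb ξ m f → MemHb ξ m fun z => f (φ z)) ∧
  ∃ C : ℝ, ∀ f, MemHb ξ m f →
    hbNormSq ξ m (fun z => f (φ z)) ≤ C * hbNormSq ξ m f

/-- The composition operator `C_φ` is compact on `H(b)`: it is bounded and the image of
every sequence in the unit ball has a subsequence whose image converges in `H(b)`. -/
def CompCompactHb {n : ℕ} (ξ : Fin n → ℂ) (m : Fin n → ℕ) (φ : ℂ → ℂ) : Prop :=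
  CompBddHb ξ m φ ∧
  ∀ f : ℕ → ℂ → ℂ, (∀ k, MemHb ξ m (f k) ∧ hbNormSq ξ m (f k) ≤ 1) →
    ∃ (κ : ℕ → ℕ) (g : ℂ → ℂ), StrictMono κ ∧ MemHb ξ m g ∧
      Tendsto (fun i => hbNormSq ξ m fun z => f (κ i) (φ z) - g z) atTop (nhds 0)

/-- The composition operator `C_φ` is Hilbert–Schmidt on `H(b)`: it is bounded and the sum
of `⦀C_φ e⦀²` over the orthonormal basis `{a₁ z^k}ₖ ∪ {z^j}_{j<N}` of
`(H(b), ⦀·⦀_b)` is finite (the finite part of the sum being automatically finite). -/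
def CompHSHb {n : ℕ} (ξ : Fin n → ℂ) (m : Fin n → ℕ) (φ : ℂ → ℂ) : Prop :=
  CompBddHb ξ m φ ∧
  Summable fun k : ℕ => hbNormSq ξ m fun z => a1fun ξ m (φ z) * φ z ^ k

/-- The weighted composition operator `W_{u,φ} f = u · (f ∘ φ)` maps `H²` boundedly
into itself. -/
def WCompBddH2 (u φ : ℂ → ℂ) : Prop :=
  (∀ f, MemH2 f → MemH2 fun z => u z * f (φ z)) ∧
  ∃ C : ℝ, ∀ f, MemH2 f →
    h2NormSq (fun z => u z * f (φ z)) ≤ C * h2NormSq f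

/-- The weighted composition operator `W_{u,φ}` is compact on `H²`. -/
def WCompCompactH2 (u φ : ℂ → ℂ) : Prop :=
  WCompBddH2 u φ ∧
  ∀ f : ℕ → ℂ → ℂ, (∀ k, MemH2 (f k) ∧ h2NormSq (f k) ≤ 1) →
    ∃ (κ : ℕ → ℕ) (g : ℂ → ℂ), StrictMono κ ∧ MemH2 g ∧
      Tendsto (fun i => h2NormSq fun z => u z * f (κ i) (φ z) - g z) atTop (nhds 0)

/-- The weighted composition operator `W_{u,φ}` is Hilbert–Schmidt on `H²`
(sum over the orthonormal basis `{z^k}` of `H²`). -/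
def WCompHSH2 (u φ : ℂ → ℂ) : Prop :=
  WCompBddH2 u φ ∧ Summable fun k : ℕ => h2NormSq fun z => u z * φ z ^ k

/-- The function `u = (a₁ ∘ φ) · ∏_{j ≥ p} (φ − φ(ξⱼ))^{mⱼ} / a₁`, where `Λ j = φ(ξ j)`
are the non-tangential limits of `φ` at the zeros of the mate. -/
def ufun {n : ℕ} (p : ℕ) (ξ : Fin n → ℂ) (m : Fin n → ℕ) (Λ : Fin n → ℂ)
    (φ : ℂ → ℂ) : ℂ → ℂ :=
  fun z => a1fun ξ m (φ z) *
    (∏ j ∈ Finset.univ.filter fun j : Fin n => p ≤ (j : ℕ), (φ z - Λ j) ^ (m j)) /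
      a1fun ξ m z

/-- The reproducing kernel of the de Branges–Rovnyak space `H(c)`:
`k_λ^c(z) = (1 − conj(c(λ)) c(z)) / (1 − conj(λ) z)`, as a function of the parameter `λ`
and the evaluation point `z`. -/
def rkKernel (c : ℂ → ℂ) (lam z : ℂ) : ℂ :=
  (1 - (starRingEnd ℂ) (c lam) * c z) / (1 - (starRingEnd ℂ) lam * z)

/-- `f` belongs to the reproducing kernel Hilbert space `H(c)` with squared norm at
most `t`: for all finite linear combinations of kernels,
`|⟨f, Σ αᵢ k_{λᵢ}⟩|² ≤ t · ‖Σ αᵢ k_{λᵢ}‖²`. -/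
def HbRKBound (c f : ℂ → ℂ) (t : ℝ) : Prop :=
  ∀ (k : ℕ) (lam α : Fin k → ℂ), (∀ i, lam i ∈ unitDisk) →
    ‖∑ i, (starRingEnd ℂ) (α i) * f (lam i)‖ ^ 2 ≤
      t * (∑ i, ∑ j, α i * (starRingEnd ℂ) (α j) * rkKernel c (lam i) (lam j)).re

/-- Membership in the de Branges–Rovnyak space `H(c)` (general RKHS definition). -/
def MemHbRK (c f : ℂ → ℂ) : Prop := ∃ t : ℝ, HbRKBound c f t

/-- `φ` has an angular derivative in the sense of Carathéodory at `ξ`: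
`φ` and `φ'` have non-tangential limits at `ξ` and `|φ(ξ)| = 1`. -/
def HasADC (φ : ℂ → ℂ) (ξ : ℂ) : Prop :=
  ∃ L L' : ℂ, ‖L‖ = 1 ∧ NTLimit φ ξ L ∧ NTLimit (deriv φ) ξ L'

/-- The measure `μ_{u,φ}(E) = ∫_{φ⁻¹(E) ∩ T} |u|² dm` (boundary values on the circle,
normalized Lebesgue measure). -/
def muMeas (u φ : ℂ → ℂ) (E : Set ℂ) : ENNReal :=
  (ENNReal.ofReal (2 * Real.pi))⁻¹ *
    ∫⁻ θ in Set.Ioc (0:ℝ) (2 * Real.pi),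
      (if bdryVal φ (Complex.exp (θ * Complex.I)) ∈ E then
        ENNReal.ofReal (‖bdryVal u (Complex.exp (θ * Complex.I))‖ ^ 2) else 0)

/-- `μ_{u,φ}` is a Carleson measure: `μ(S(ζ,r)) ≤ M r` for all Carleson windows
`S(ζ,r) = {z : |z| ≤ 1, |z − ζ| ≤ r}`, `ζ ∈ T`, `0 < r < 1`. -/
def IsCarleson (u φ : ℂ → ℂ) : Prop :=
  ∃ M : ℝ, 0 < M ∧ ∀ ζ ∈ unitCircle, ∀ r ∈ Set.Ioo (0:ℝ) 1,
    muMeas u φ (Metric.closedBall ζ r ∩ Metric.closedBall 0 1) ≤ ENNReal.ofReal (M * r)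

/-- `μ_{u,φ}` is a vanishing Carleson measure: `sup_{ζ∈T} μ(S(ζ,r))/r → 0` as `r → 0`. -/
def IsVanishingCarleson (u φ : ℂ → ℂ) : Prop :=
  ∀ ε > (0:ℝ), ∃ r₀ ∈ Set.Ioo (0:ℝ) 1, ∀ r ∈ Set.Ioo (0:ℝ) r₀, ∀ ζ ∈ unitCircle,
    muMeas u φ (Metric.closedBall ζ r ∩ Metric.closedBall 0 1) ≤ ENNReal.ofReal (ε * r)

/-- The reproducing kernel integral
`∫_T (1 − |w|²) |u(ξ)|² / |1 − conj(w) φ(ξ)|² dm(ξ)`. -/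
def repKerInt (u φ : ℂ → ℂ) (w : ℂ) : ENNReal :=
  (ENNReal.ofReal (2 * Real.pi))⁻¹ *
    ∫⁻ θ in Set.Ioc (0:ℝ) (2 * Real.pi),
      ENNReal.ofReal ((1 - ‖w‖ ^ 2) * ‖bdryVal u (Complex.exp (θ * Complex.I))‖ ^ 2 /
        ‖1 - (starRingEnd ℂ) w * bdryVal φ (Complex.exp (θ * Complex.I))‖ ^ 2)



theorem mem_unitDisk_iff {z : ℂ} : z ∈ unitDisk ↔ ‖z‖ < 1 := by
  simp [unitDisk]

theorem zero_mem_unitDisk : (0:ℂ) ∈ unitDisk := by simp [unitDisk]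

theorem hasSum_taylorCoeff {f : ℂ → ℂ} (hf : DifferentiableOn ℂ f unitDisk) {z : ℂ}
    (hz : z ∈ unitDisk) : HasSum (fun k => taylorCoeff f k * z ^ k) (f z) := by
  have h := Complex.hasSum_taylorSeries_on_ball hf hz
  have he : (fun k => taylorCoeff f k * z ^ k) =
      fun n : ℕ => ((n.factorial : ℂ))⁻¹ • (z - 0) ^ n • iteratedDeriv n f 0 := by
    funext k
    simp only [taylorCoeff, smul_eq_mul, sub_zero]
    ring
  rw [he]
  exact h

theorem of_hasSum {f : ℂ → ℂ} {c : ℕ → ℂ}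
    (h : ∀ z ∈ unitDisk, HasSum (fun k => c k * z ^ k) (f z)) :
    DifferentiableOn ℂ f unitDisk ∧ ∀ k, taylorCoeff f k = c k := by
  have hp : HasFPowerSeriesOnBall f (FormalMultilinearSeries.ofScalars ℂ c) 0 1 := by
    refine ⟨?_, one_pos, ?_⟩
    · refine ENNReal.le_of_forall_nnreal_lt fun r hr => ?_
      have hr' : (r : ℝ) < 1 := by exact_mod_cast hr
      have hs := (h (r:ℂ) (by simpa [mem_unitDisk_iff] using hr')).summable.tendsto_atTop_zero.norm
      refine FormalMultilinearSeries.le_radius_of_tendsto _ (l := ‖(0:ℂ)‖) ?_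
      refine hs.congr fun k => ?_
      simp [FormalMultilinearSeries.ofScalars_norm]
    · intro y hy
      have hy' : ‖y‖ < 1 := by
        rw [Metric.mem_eball, edist_zero_right, ← ofReal_norm, ENNReal.ofReal_lt_one] at hy
        exact hy
      have := h y (mem_unitDisk_iff.2 hy')
      simpa [FormalMultilinearSeries.ofScalars_apply_eq, mul_comm] using this
  constructor
  · have := hp.differentiableOn
    refine this.mono ?_
    intro z hz
    rw [Metric.mem_eball, edist_zero_right, ← ofReal_norm, ENNReal.ofReal_lt_one]
    exact mem_unitDisk_iff.1 hz
  · intro k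
    have := hp.factorial_smul (1:ℂ) k
    rw [taylorCoeff, iteratedDeriv_eq_iteratedFDeriv, ← this]
    have : (k.factorial : ℂ) ≠ 0 := by exact_mod_cast k.factorial_ne_zero
    simp [FormalMultilinearSeries.ofScalars_apply_eq]
    field_simp

theorem taylorCoeff_congr {f g : ℂ → ℂ} (hg : DifferentiableOn ℂ g unitDisk)
    (h : ∀ z ∈ unitDisk, f z = g z) (k : ℕ) : taylorCoeff f k = taylorCoeff g k :=
  (of_hasSum (f := f) (c := taylorCoeff g) fun z hz => by
    rw [h z hz]; exact hasSum_taylorCoeff hg hz).2 k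

theorem MemH2.congr {f g : ℂ → ℂ} (hg : MemH2 g)
    (h : ∀ z ∈ unitDisk, f z = g z) : MemH2 f :=
  ⟨hg.1.congr h, by simpa only [taylorCoeff_congr hg.1 h] using hg.2⟩

theorem taylorCoeff_add {f g : ℂ → ℂ} (hf : DifferentiableOn ℂ f unitDisk)
    (hg : DifferentiableOn ℂ g unitDisk) (k : ℕ) :
    taylorCoeff (fun z => f z + g z) k = taylorCoeff f k + taylorCoeff g k :=
  (of_hasSum (f := fun z => f z + g z) (c := fun k => taylorCoeff f k + taylorCoeff g k)
    fun z hz => by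
      simpa only [add_mul] using (hasSum_taylorCoeff hf hz).add (hasSum_taylorCoeff hg hz)).2 k

theorem MemH2.add {f g : ℂ → ℂ} (hf : MemH2 f) (hg : MemH2 g) :
    MemH2 fun z => f z + g z := by
  refine ⟨hf.1.add hg.1, ?_⟩
  refine Summable.of_nonneg_of_le (fun _ => by positivity) (fun k => ?_)
    ((hf.2.add hg.2).mul_left 2)
  rw [taylorCoeff_add hf.1 hg.1]
  have := norm_add_le (taylorCoeff f k) (taylorCoeff g k)
  nlinarith [sq_nonneg (‖taylorCoeff f k‖ - ‖taylorCoeff g k‖),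
    norm_nonneg (taylorCoeff f k + taylorCoeff g k)]

/-- Power series with square summable coefficients. -/
theorem memH2_of_hasSum {f : ℂ → ℂ} {c : ℕ → ℂ}
    (h : ∀ z ∈ unitDisk, HasSum (fun k => c k * z ^ k) (f z))
    (hc : Summable fun k => ‖c k‖ ^ 2) : MemH2 f :=
  ⟨(of_hasSum h).1, by simpa only [(of_hasSum h).2] using hc⟩

theorem hasSum_poly (q : Polynomial ℂ) (z : ℂ) :
    HasSum (fun k => q.coeff k * z ^ k) (q.eval z) := by
  rw [Polynomial.eval_eq_sum_range]
  apply hasSum_sum_of_ne_finset_zero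
  intro b hb
  rw [Polynomial.coeff_eq_zero_of_natDegree_lt, zero_mul]
  simpa using hb

theorem taylorCoeff_poly (q : Polynomial ℂ) (k : ℕ) :
    taylorCoeff (fun z => q.eval z) k = q.coeff k :=
  (of_hasSum (f := fun z => q.eval z) fun z _ => hasSum_poly q z).2 k

theorem memH2_poly (q : Polynomial ℂ) : MemH2 fun z => q.eval z := by
  refine memH2_of_hasSum (fun z _ => hasSum_poly q z) ?_
  refine summable_of_ne_finset_zero (s := Finset.range (q.natDegree + 1)) ?_
  intro b hb
  rw [Polynomial.coeff_eq_zero_of_natDegree_lt]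
  · simp
  simpa using hb

instance fact_two_pi_pos : Fact (0 < 2 * Real.pi) := ⟨Real.two_pi_pos⟩

/-- The restriction of `f` to the circle of radius `r`. -/
def circMap (f : ℂ → ℂ) (hf : DifferentiableOn ℂ f unitDisk) (r : ℝ) (h0 : 0 ≤ r)
    (h1 : r < 1) : C(AddCircle (2 * Real.pi), ℂ) where
  toFun x := f (r * fourier 1 x)
  continuous_toFun := by
    refine hf.continuousOn.comp_continuous (by fun_prop) fun x => ?_
    rw [mem_unitDisk_iff, norm_mul, fourier_one, Circle.norm_coe]
    simpa [abs_of_nonneg h0] using h1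

theorem circle_mem {r : ℝ} (h0 : 0 ≤ r) (h1 : r < 1) (x : AddCircle (2 * Real.pi)) :
    (r * fourier 1 x : ℂ) ∈ unitDisk ∧ ‖(r * fourier 1 x : ℂ)‖ = r := by
  have : ‖(r * fourier 1 x : ℂ)‖ = r := by
    rw [norm_mul, fourier_one, Circle.norm_coe]
    simp [abs_of_nonneg h0] 
  exact ⟨by rw [mem_unitDisk_iff, this]; exact h1, this⟩

theorem parseval {f : ℂ → ℂ} (hf : DifferentiableOn ℂ f unitDisk) {r : ℝ} (h0 : 0 ≤ r)
    (h1 : r < 1) : HasSum (fun k => ‖taylorCoeff f k * (r:ℂ) ^ k‖ ^ 2)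
      (‖ContinuousMap.toLp (E := ℂ) 2 (AddCircle.haarAddCircle (T := 2 * Real.pi)) ℂ
        (circMap f hf r h0 h1)‖ ^ 2) := by
  have hs : Summable fun k : ℕ => (taylorCoeff f k * (r:ℂ) ^ k) •
      (fourier (k:ℤ) : C(AddCircle (2 * Real.pi), ℂ)) := by
    refine Summable.of_norm ?_
    have := (hasSum_taylorCoeff hf (z := r)
      (by simpa [mem_unitDisk_iff, abs_of_nonneg h0] using h1)).summable.norm
    refine this.congr fun k => ?_
    rw [norm_smul, fourier_norm, mul_one]
  have he : HasSum (fun k : ℕ => (taylorCoeff f k * (r:ℂ) ^ k) •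
      (fourier (k:ℤ) : C(AddCircle (2 * Real.pi), ℂ))) (circMap f hf r h0 h1) := by
    convert hs.hasSum using 1
    ext x
    have h2 := (ContinuousMap.hasSum_apply hs.hasSum x)
    refine HasSum.unique ?_ h2
    have h3 := hasSum_taylorCoeff hf (circle_mem h0 h1 x).1
    have he : (fun i : ℕ => ((taylorCoeff f i * (r:ℂ) ^ i) •
        (fourier (i:ℤ) : C(AddCircle (2 * Real.pi), ℂ))) x) =
        fun k => taylorCoeff f k * (r * fourier 1 x) ^ k := by
      funext k
      simp only [ContinuousMap.smul_apply, fourier_apply, mul_pow, mul_assoc, smul_eq_mul]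
      rw [← Circle.coe_pow, AddCircle.toCircle_zsmul, AddCircle.toCircle_zsmul]
      simp
    rw [he]
    exact h3
  have hL := he.mapL (ContinuousMap.toLp (E := ℂ) 2 
    (AddCircle.haarAddCircle (T := 2 * Real.pi)) ℂ)
  have hn := (hL.norm.pow 2)
  refine hn.congr fun s => ?_
  have hor := (orthonormal_fourier (T := 2 * Real.pi)).comp (fun k : ℕ => (k:ℤ))
    Nat.cast_injective
  have := hor.inner_sum (fun k => taylorCoeff f k * (r:ℂ) ^ k) 
    (fun k => taylorCoeff f k * (r:ℂ) ^ k) s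
  rw [@norm_sq_eq_re_inner ℂ]
  simp only [map_smul]
  erw [this]
  rw [map_sum]
  refine Finset.sum_congr rfl fun k _ => ?_
  rw [← Complex.normSq_eq_conj_mul_self, Complex.normSq_eq_norm_sq]
  exact (Complex.ofReal_re _).symm

theorem MemH2.of_le {f g : ℂ → ℂ} (hf : DifferentiableOn ℂ f unitDisk) (hg : MemH2 g)
    {A r₀ : ℝ} (hr₀ : r₀ < 1) (hA : 0 ≤ A)
    (h : ∀ z ∈ unitDisk, r₀ ≤ ‖z‖ → ‖f z‖ ≤ A * ‖g z‖) : MemH2 f := by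
  refine ⟨hf, ?_⟩
  set C := ∑' k, ‖taylorCoeff g k‖ ^ 2
  refine summable_of_sum_le (c := A ^ 2 * C) (fun _ => by positivity) fun s => ?_
  have key : ∀ r : ℝ, 0 ≤ r → r₀ ≤ r → r < 1 →
      ∑ k ∈ s, ‖taylorCoeff f k * (r:ℂ) ^ k‖ ^ 2 ≤ A ^ 2 * C := by
    intro r h0 hr h1
    have p1 := parseval hf h0 h1
    have p2 := parseval hg.1 h0 h1
    have q1 := sum_le_hasSum s (fun _ _ => by positivity) p1
    have q2 : ‖ContinuousMap.toLp (E := ℂ) 2 (AddCircle.haarAddCircle (T := 2 * Real.pi)) ℂ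
        (circMap g hg.1 r h0 h1)‖ ^ 2 ≤ C := by
      rw [← p2.tsum_eq]
      refine p2.summable.tsum_le_tsum (fun k => ?_) hg.2
      gcongr
      rw [norm_mul, norm_pow]
      refine mul_le_of_le_one_right (norm_nonneg _) (pow_le_one₀ (norm_nonneg _) ?_)
      simpa [abs_of_nonneg h0] using h1.le
    have q3 : ‖ContinuousMap.toLp (E := ℂ) 2 (AddCircle.haarAddCircle (T := 2 * Real.pi)) ℂ
        (circMap f hf r h0 h1)‖ ≤ A * ‖ContinuousMap.toLp (E := ℂ) 2 
        (AddCircle.haarAddCircle (T := 2 * Real.pi)) ℂ (circMap g hg.1 r h0 h1)‖ := by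
      refine Lp.norm_le_mul_norm_of_ae_le_mul ?_
      filter_upwards [ContinuousMap.coeFn_toLp (p := 2) (𝕜 := ℂ) 
        (AddCircle.haarAddCircle (T := 2 * Real.pi)) (circMap f hf r h0 h1),
        ContinuousMap.coeFn_toLp (p := 2) (𝕜 := ℂ) 
        (AddCircle.haarAddCircle (T := 2 * Real.pi)) (circMap g hg.1 r h0 h1)] with x e1 e2
      rw [e1, e2]
      have := circle_mem h0 h1 x
      exact h _ this.1 (by rw [this.2]; exact hr)
    calc _ ≤ _ := q1
      _ ≤ (A * ‖ContinuousMap.toLp (E := ℂ) 2 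
        (AddCircle.haarAddCircle (T := 2 * Real.pi)) ℂ (circMap g hg.1 r h0 h1)‖) ^ 2 := by gcongr
      _ ≤ _ := by rw [mul_pow]; gcongr
  have ht : Tendsto (fun r : ℝ => ∑ k ∈ s, ‖taylorCoeff f k * (r:ℂ) ^ k‖ ^ 2)
      (nhdsWithin 1 (Set.Iio 1)) (nhds (∑ k ∈ s, ‖taylorCoeff f k‖ ^ 2)) := by
    have : Continuous fun r : ℝ => ∑ k ∈ s, ‖taylorCoeff f k * (r:ℂ) ^ k‖ ^ 2 := by fun_prop
    have := this.tendsto 1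
    simp only [ofReal_one, one_pow, mul_one] at this
    exact this.mono_left nhdsWithin_le_nhds
  refine le_of_tendsto ht ?_
  have : Set.Ioo (max 0 r₀) 1 ∈ nhdsWithin (1:ℝ) (Set.Iio 1) :=
    Ioo_mem_nhdsLT (by simp [hr₀])
  filter_upwards [this] with r hr
  have := max_lt_iff.1 hr.1
  exact key r this.1.le this.2.le hr.2

theorem MemH2.bdd_mul {f g : ℂ → ℂ} (hf : DifferentiableOn ℂ f unitDisk) (hg : MemH2 g)
    {A : ℝ} (h : ∀ z ∈ unitDisk, ‖f z‖ ≤ A) : MemH2 fun z => f z * g z := by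
  have hA : 0 ≤ A := (norm_nonneg _).trans (h 0 zero_mem_unitDisk)
  refine MemH2.of_le (hf.mul hg.1) hg zero_lt_one hA fun z hz _ => ?_
  rw [norm_mul]
  gcongr
  exact h z hz

theorem poly_bdd (q : Polynomial ℂ) : ∃ A : ℝ, ∀ z : ℂ, ‖z‖ ≤ 1 → ‖q.eval z‖ ≤ A := by
  obtain ⟨A, hA⟩ := (isCompact_closedBall (0:ℂ) 1).exists_bound_of_continuousOn
    (f := fun z => q.eval z) (by fun_prop)
  exact ⟨A, fun z hz => hA z (by simpa using hz)⟩

theorem MemH2.poly_mul (q : Polynomial ℂ) {g : ℂ → ℂ} (hg : MemH2 g) :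
    MemH2 fun z => q.eval z * g z := by
  obtain ⟨A, hA⟩ := poly_bdd q
  exact hg.bdd_mul (by fun_prop) (A := A) fun z hz => hA z (mem_unitDisk_iff.1 hz).le

theorem MemH2.const_mul (c : ℂ) {g : ℂ → ℂ} (hg : MemH2 g) :
    MemH2 fun z => c * g z := by
  simpa using hg.poly_mul (Polynomial.C c)

/-- Division by `z - lam`. -/
theorem MemH2.exists_div {g : ℂ → ℂ} (hg : MemH2 g) {lam : ℂ} (hl : lam ∈ unitDisk) :
    ∃ g₂, MemH2 g₂ ∧ ∀ z ∈ unitDisk, g z = (z - lam) * g₂ z + g lam := by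
  have hl' := mem_unitDisk_iff.1 hl
  refine ⟨dslope g lam, ?_, fun z hz => ?_⟩
  · have hsub : MemH2 fun z => g z + (Polynomial.C (-g lam)).eval z := hg.add (memH2_poly _)
    refine MemH2.of_le (r₀ := (1 + ‖lam‖) / 2) (A := 2 / (1 - ‖lam‖)) ?_ hsub (by linarith)
      (by apply div_nonneg <;> linarith) ?_
    · exact (Complex.differentiableOn_dslope (Metric.isOpen_ball.mem_nhds hl)).2 hg.1
    · intro z hz hr
      have hne : z ≠ lam := by rintro rfl; linarith
      have h3 : (1 - ‖lam‖) / 2 ≤ ‖z - lam‖ := by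
        have := norm_sub_norm_le z lam; linarith
      rw [dslope_of_ne _ hne, slope_def_field, norm_div, Polynomial.eval_C, ← sub_eq_add_neg,
        div_le_iff₀ (by linarith)]
      have h4 : 1 ≤ 2 / (1 - ‖lam‖) * ‖z - lam‖ := by
        rw [div_mul_eq_mul_div, le_div_iff₀ (by linarith)]; linarith
      nlinarith [norm_nonneg (g z - g lam)]
  · have := sub_smul_dslope g lam z
    rw [smul_eq_mul] at this
    rw [this]; ring


/-- A consequence of the closed graph theorem. -/
theorem abstract_bdd {X Y ι : Type*} [NormedAddCommGroup X] [NormedSpace ℂ X] [CompleteSpace X]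
    [NormedAddCommGroup Y] [NormedSpace ℂ Y] [CompleteSpace Y]
    (e : ι → Y →L[ℂ] ℂ) (e' : ι → X →L[ℂ] ℂ) (sep : ∀ y, (∀ i, e i y = 0) → y = 0)
    (ex : ∀ x, ∃ y, ∀ i, e i y = e' i x) :
    ∃ C, 0 ≤ C ∧ ∀ x y, (∀ i, e i y = e' i x) → ‖y‖ ≤ C * ‖x‖ := by
  have sep' : ∀ y y', (∀ i, e i y = e i y') → y = y' := fun y y' h =>
    sub_eq_zero.1 (sep _ fun i => by rw [map_sub, h i, sub_self])
  choose T hT using ex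
  let S : X →ₗ[ℂ] Y :=
    { toFun := T
      map_add' := fun x x' => sep' _ _ fun i => by simp [hT]
      map_smul' := fun c x => sep' _ _ fun i => by simp [hT] }
  have hS : Continuous S := by
    refine LinearMap.continuous_of_seq_closed_graph S ?_
    intro u x y hu hy
    refine sep' _ _ fun i => ?_
    have h1 := ((e i).continuous.tendsto y).comp hy
    have h2 := ((e' i).continuous.tendsto x).comp hu
    have : (⇑(e i) ∘ ⇑S ∘ u) = ⇑(e' i) ∘ u := by
      funext k; exact hT _ i
    rw [this] at h1
    rw [tendsto_nhds_unique h1 h2]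
    exact (hT x i).symm
  let S' : X →L[ℂ] Y := ⟨S, hS⟩
  refine ⟨‖S'‖, norm_nonneg _, fun x y h => ?_⟩
  have : y = S' x := sep' _ _ fun i => by rw [h i]; exact (hT x i).symm
  rw [this]
  exact S'.le_opNorm x

/-- Abbreviation for the sequence space. -/
abbrev ell2 : Type := lp (fun _ : ℕ => ℂ) 2

theorem memlp_two_iff {c : ℕ → ℂ} :
    Memℓp (E := fun _ : ℕ => ℂ) c 2 ↔ Summable fun k => ‖c k‖ ^ 2 := by
  rw [memℓp_gen_iff (by norm_num)]
  simp

theorem ell2_norm_sq (c : ell2) : ‖c‖ ^ 2 = ∑' k, ‖c k‖ ^ 2 := by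
  have := lp.norm_rpow_eq_tsum (p := 2) (by norm_num) c
  simpa using this

theorem kern_hasSum {z : ℂ} (hz : z ∈ unitDisk) :
    HasSum (fun k : ℕ => ‖((starRingEnd ℂ) z) ^ k‖ ^ 2) (1 - ‖z‖ ^ 2)⁻¹ := by
  have hz' := mem_unitDisk_iff.1 hz
  have := hasSum_geometric_of_lt_one (r := ‖z‖ ^ 2) (by positivity)
    (by nlinarith [norm_nonneg z])
  refine this.congr_fun ?_ |> fun h => h
  intro k
  simp [← pow_mul, mul_comm]

/-- The Szegő kernel as an element of `ell2`. -/
def kern (z : unitDisk) : ell2 :=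
  ⟨fun k => ((starRingEnd ℂ) (z:ℂ)) ^ k, memlp_two_iff.2 (kern_hasSum z.2).summable⟩

/-- Evaluation functional. -/
def ev (z : unitDisk) : ell2 →L[ℂ] ℂ := innerSL ℂ (kern z)

theorem ev_hasSum (z : unitDisk) (c : ell2) : HasSum (fun k => c k * (z:ℂ) ^ k) (ev z c) := by
  have := lp.hasSum_inner (𝕜 := ℂ) (kern z) c
  simpa [kern, ev] using this

/-- Coefficient sequence of an `H²` function. -/
def vec (f : ℂ → ℂ) (hf : MemH2 f) : ell2 := ⟨taylorCoeff f, memlp_two_iff.2 hf.2⟩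

theorem vec_apply (f : ℂ → ℂ) (hf : MemH2 f) (k : ℕ) : vec f hf k = taylorCoeff f k := rfl

theorem ev_vec (f : ℂ → ℂ) (hf : MemH2 f) (z : unitDisk) : ev z (vec f hf) = f z :=
  (ev_hasSum z _).unique (hasSum_taylorCoeff hf.1 z.2)

theorem norm_vec (f : ℂ → ℂ) (hf : MemH2 f) : ‖vec f hf‖ ^ 2 = h2NormSq f :=
  ell2_norm_sq _

/-- The function with given coefficient sequence. -/
def fn (c : ell2) (z : ℂ) : ℂ := if h : z ∈ unitDisk then ev ⟨z, h⟩ c else 0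

theorem fn_eq (c : ell2) (z : unitDisk) : fn c z = ev z c := by
  simp [fn]

theorem fn_hasSum (c : ell2) : ∀ z ∈ unitDisk, HasSum (fun k => c k * z ^ k) (fn c z) :=
  fun z hz => by
    rw [fn_eq c ⟨z, hz⟩]
    exact ev_hasSum ⟨z, hz⟩ c

theorem memH2_fn (c : ell2) : MemH2 (fn c) :=
  memH2_of_hasSum (fn_hasSum c) (memlp_two_iff.1 c.2)

theorem taylorCoeff_fn (c : ell2) (k : ℕ) : taylorCoeff (fn c) k = c k :=
  (of_hasSum (fn_hasSum c)).2 k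

theorem ev_sep (c : ell2) (h : ∀ z, ev z c = 0) : c = 0 := by
  ext k
  rw [← taylorCoeff_fn c k]
  have := (of_hasSum (f := fn c) (c := fun _ => 0) fun z hz => by
    rw [fn_eq c ⟨z, hz⟩, h]; simpa using hasSum_zero).2 k
  simpa using this

theorem growth {g : ℂ → ℂ} (hg : MemH2 g) {z : ℂ} (hz : z ∈ unitDisk) :
    ‖g z‖ ^ 2 * (1 - ‖z‖) ≤ h2NormSq g := by
  have hz' := mem_unitDisk_iff.1 hz
  have h1 : ‖g z‖ ≤ ‖kern ⟨z, hz⟩‖ * ‖vec g hg‖ := by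
    rw [← ev_vec g hg ⟨z, hz⟩]
    exact norm_inner_le_norm (𝕜 := ℂ) (kern ⟨z, hz⟩) (vec g hg)
  have h2 : ‖kern ⟨z, hz⟩‖ ^ 2 = (1 - ‖z‖ ^ 2)⁻¹ := by
    rw [ell2_norm_sq]; exact (kern_hasSum hz).tsum_eq
  have h3 : 0 < 1 - ‖z‖ ^ 2 := by nlinarith [norm_nonneg z]
  have h4 : (1 - ‖z‖) ≤ 1 - ‖z‖ ^ 2 := by nlinarith [norm_nonneg z]
  rw [← norm_vec g hg]
  calc ‖g z‖ ^ 2 * (1 - ‖z‖) ≤ (‖kern ⟨z, hz⟩‖ * ‖vec g hg‖) ^ 2 * (1 - ‖z‖ ^ 2) := by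
        gcongr
    _ = ‖vec g hg‖ ^ 2 := by
        rw [mul_pow, h2]; field_simp

theorem h2NormSq_nonneg (g : ℂ → ℂ) : 0 ≤ h2NormSq g := tsum_nonneg fun _ => by positivity

theorem growth_sqrt {g : ℂ → ℂ} (hg : MemH2 g) {z : ℂ} (hz : z ∈ unitDisk) :
    ‖g z‖ * √(1 - ‖z‖) ≤ √(h2NormSq g) := by
  have hz' := mem_unitDisk_iff.1 hz
  apply Real.le_sqrt_of_sq_le
  rw [mul_pow, Real.sq_sqrt (by linarith)]
  exact growth hg hz

/-- The radial point. -/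
def rad (ξ : ℂ) (t : ℝ) : ℂ := (1 - (t:ℂ)) * ξ

theorem rad_norm {ξ : ℂ} (hξ : ‖ξ‖ = 1) {t : ℝ} (ht : t ∈ Set.Ioo (0:ℝ) 1) :
    ‖rad ξ t‖ = 1 - t := by
  rw [rad, norm_mul, hξ, mul_one, ← ofReal_one, ← ofReal_sub, norm_real, Real.norm_eq_abs,
    abs_of_pos (by linarith [ht.2])]

theorem rad_mem {ξ : ℂ} (hξ : ‖ξ‖ = 1) {t : ℝ} (ht : t ∈ Set.Ioo (0:ℝ) 1) :
    rad ξ t ∈ unitDisk := by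
  rw [mem_unitDisk_iff, rad_norm hξ ht]; linarith [ht.1]

theorem ev_Ioo : ∀ᶠ t in nhdsWithin (0:ℝ) (Set.Ioi 0), t ∈ Set.Ioo (0:ℝ) 1 :=
  Ioo_mem_nhdsGT one_pos

theorem rad_tendsto (ξ : ℂ) : Tendsto (rad ξ) (nhdsWithin (0:ℝ) (Set.Ioi 0)) (nhds ξ) := by
  have : Continuous (rad ξ) := by unfold rad; fun_prop
  have h := this.tendsto 0
  simp only [rad, ofReal_zero, sub_zero, one_mul] at h
  exact h.mono_left nhdsWithin_le_nhds

theorem little_growth {g : ℂ → ℂ} (hg : MemH2 g) {ξ : ℂ} (hξ : ‖ξ‖ = 1) :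
    Tendsto (fun t : ℝ => √t * ‖g (rad ξ t)‖) (nhdsWithin (0:ℝ) (Set.Ioi 0)) (nhds 0) := by
  have hmain : ∀ ε > 0, ∃ q : Polynomial ℂ, MemH2 (fun z => g z - q.eval z) ∧
      √(h2NormSq (fun z => g z - q.eval z)) < ε := by
    intro ε hε
    have ht := tendsto_sum_nat_add fun k => ‖taylorCoeff g k‖ ^ 2
    obtain ⟨K, hK⟩ := (ht.eventually (gt_mem_nhds (by positivity : (0:ℝ) < ε ^ 2))).exists
    let q : Polynomial ℂ := ∑ i ∈ Finset.range K, Polynomial.monomial i (taylorCoeff g i)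
    have hmem : MemH2 (fun z => g z - q.eval z) :=
      (hg.add (memH2_poly (-q))).congr fun z _ => by simp [sub_eq_add_neg]
    have hc : ∀ k, taylorCoeff (fun z => g z - q.eval z) k =
        if k < K then 0 else taylorCoeff g k := by
      intro k
      have e1 : taylorCoeff (fun z => g z - q.eval z) k =
        taylorCoeff (fun z => g z + (-q).eval z) k := by
          congr 1; funext z; simp [sub_eq_add_neg]
      rw [e1, taylorCoeff_add hg.1 (memH2_poly _).1, taylorCoeff_poly]
      simp only [q, Polynomial.coeff_neg, Polynomial.finsetSum_coeff, Polynomial.coeff_monomial,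
        Finset.sum_ite_eq', Finset.mem_range]
      split_ifs <;> simp
    refine ⟨q, hmem, ?_⟩
    rw [Real.sqrt_lt' hε]
    refine lt_of_eq_of_lt ?_ hK
    rw [h2NormSq, ← hmem.2.sum_add_tsum_nat_add K, Finset.sum_eq_zero, zero_add]
    · simp [hc]
    · intro k hk; simp [hc, Finset.mem_range.1 hk]
  rw [Metric.tendsto_nhds]
  intro ε hε
  obtain ⟨q, hq, hqε⟩ := hmain (ε / 2) (by positivity)
  obtain ⟨A, hA⟩ := poly_bdd q
  have hs : Tendsto (fun t : ℝ => √t * A) (nhdsWithin (0:ℝ) (Set.Ioi 0)) (nhds 0) := by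
    have : Continuous fun t : ℝ => √t * A := by fun_prop
    simpa using (this.tendsto 0).mono_left nhdsWithin_le_nhds
  filter_upwards [hs.eventually (gt_mem_nhds (by positivity : 0 < ε / 2)), ev_Ioo] with t h1 ht
  have hm := rad_mem hξ ht
  have h2 := growth_sqrt hq hm
  rw [rad_norm hξ ht, sub_sub_cancel] at h2
  have h3 := hA (rad ξ t) (mem_unitDisk_iff.1 hm).le
  have h4 : ‖g (rad ξ t)‖ ≤ ‖g (rad ξ t) - q.eval (rad ξ t)‖ + ‖q.eval (rad ξ t)‖ := by
    simpa using norm_add_le (g (rad ξ t) - q.eval (rad ξ t)) (q.eval (rad ξ t))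
  rw [dist_zero_right, Real.norm_eq_abs, abs_of_nonneg (by positivity)]
  nlinarith [Real.sqrt_nonneg t]

/-- Bounded weighted composition operators: mapping property suffices. -/
theorem wcomp_iff {u φ : ℂ → ℂ} (hφmap : ∀ z ∈ unitDisk, φ z ∈ unitDisk) :
    WCompBddH2 u φ ↔ ∀ f, MemH2 f → MemH2 fun z => u z * f (φ z) := by
  refine ⟨fun h => h.1, fun h => ⟨h, ?_⟩⟩
  obtain ⟨C, hC0, hC⟩ := abstract_bdd (X := ell2) (Y := ell2) ev
    (fun z => u z • ev ⟨φ z, hφmap z z.2⟩) ev_sep (fun c => by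
      refine ⟨vec _ (h _ (memH2_fn c)), fun z => ?_⟩
      rw [ev_vec, fn_eq c ⟨φ z, hφmap z z.2⟩]
      rfl)
  refine ⟨C ^ 2, fun f hf => ?_⟩
  have := hC (vec f hf) (vec _ (h f hf)) fun z => by
    rw [ev_vec, smul_apply, ev_vec]; rfl
  rw [← norm_vec f hf, ← norm_vec _ (h f hf), ← mul_pow]
  gcongr


section HbPart

open scoped Asymptotics Topology

variable {n : ℕ} {ξ : Fin n → ℂ} {m : Fin n → ℕ}

/-- `a₁` as a polynomial. -/
def a1P (ξ : Fin n → ℂ) (m : Fin n → ℕ) : Polynomial ℂ :=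
  ∏ j, (Polynomial.X - Polynomial.C (ξ j)) ^ (m j)

theorem a1P_eval (z : ℂ) : (a1P ξ m).eval z = a1fun ξ m z := by
  simp [a1P, a1fun, Polynomial.eval_prod]

theorem a1P_monic : (a1P ξ m).Monic :=
  Polynomial.monic_prod_of_monic _ _ fun j _ => (Polynomial.monic_X_sub_C _).pow _

theorem a1P_degree : (a1P ξ m).degree = ((∑ j, m j : ℕ) : WithBot ℕ) := by
  rw [Polynomial.degree_eq_natDegree a1P_monic.ne_zero, a1P,
    Polynomial.natDegree_prod_of_monic _ _ fun j _ => (Polynomial.monic_X_sub_C _).pow _]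
  simp

theorem memHb_of {f k : ℂ → ℂ} {P : Polynomial ℂ} (hk : MemH2 k)
    (h : ∀ z ∈ unitDisk, f z = a1fun ξ m z * k z + P.eval z) : MemHb ξ m f := by
  refine ⟨(fun z => k z + (P /ₘ a1P ξ m).eval z, P %ₘ a1P ξ m), hk.add (memH2_poly _), ?_, ?_⟩
  · rw [← a1P_degree (ξ := ξ)]
    exact Polynomial.degree_modByMonic_lt _ a1P_monic
  · intro z hz
    have := congrArg (Polynomial.eval z) (Polynomial.modByMonic_add_div P (a1P ξ m))
    rw [Polynomial.eval_add, Polynomial.eval_mul, a1P_eval] at this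
    rw [h z hz, ← this]
    ring

theorem rad_sub (w : ℂ) (t : ℝ) : rad w t - w = -(t:ℂ) * w := by
  simp only [rad]; ring

theorem rad_sub_norm {w : ℂ} (hw : ‖w‖ = 1) {t : ℝ} (ht : 0 < t) : ‖rad w t - w‖ = t := by
  rw [rad_sub, norm_mul, hw, norm_neg, norm_real, Real.norm_eq_abs, abs_of_pos ht, mul_one]

theorem poly_tendsto (P : Polynomial ℂ) (w : ℂ) :
    Tendsto (fun t => P.eval (rad w t)) (𝓝[>] 0) (𝓝 (P.eval w)) :=
  (P.continuous.tendsto w).comp (rad_tendsto w)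

theorem bigO_of_dvd {w : ℂ} (hw : ‖w‖ = 1) {P : Polynomial ℂ} {k : ℕ}
    (h : (Polynomial.X - Polynomial.C w) ^ k ∣ P) :
    (fun t => P.eval (rad w t)) =O[𝓝[>] 0] fun t : ℝ => t ^ k := by
  obtain ⟨A, rfl⟩ := h
  have h1 : (fun t => (rad w t - w) ^ k) =O[𝓝[>] 0] fun t : ℝ => t ^ k := by
    refine Asymptotics.IsBigO.of_bound 1 ?_
    filter_upwards [self_mem_nhdsWithin] with t ht
    rw [norm_pow, rad_sub_norm hw ht, norm_pow, Real.norm_eq_abs, abs_of_pos ht, one_mul]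
  have h2 := (poly_tendsto A w).isBigO_one ℝ
  have := h1.mul h2
  simpa [Polynomial.eval_mul] using this

theorem dvd_of_littleO {w : ℂ} (hw : ‖w‖ = 1) {P : Polynomial ℂ} {k : ℕ} (hk : 0 < k)
    (h : (fun t => P.eval (rad w t)) =o[𝓝[>] 0] fun t : ℝ => t ^ (k - 1)) :
    (Polynomial.X - Polynomial.C w) ^ k ∣ P := by
  by_cases hP : P = 0
  · simp [hP]
  by_contra hcon
  have hlt : P.rootMultiplicity w < k := by
    by_contra hge
    exact hcon ((pow_dvd_pow _ (not_lt.1 hge)).trans (Polynomial.pow_rootMultiplicity_dvd P w))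
  obtain ⟨A, hA, hnd⟩ := Polynomial.exists_eq_pow_rootMultiplicity_mul_and_not_dvd P hP w
  set d := P.rootMultiplicity w
  have hAw : A.eval w ≠ 0 := by
    intro h0; exact hnd (Polynomial.dvd_iff_isRoot.2 h0)
  have h1 : (fun t => A.eval (rad w t)) =o[𝓝[>] 0] fun _ : ℝ => (1:ℝ) := by
    rw [Asymptotics.isLittleO_iff] at h ⊢
    intro c hc
    filter_upwards [h hc, ev_Ioo] with t ht1 ht
    rw [hA, Polynomial.eval_mul, norm_mul, Polynomial.eval_pow, norm_pow, Polynomial.eval_sub,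
      Polynomial.eval_X, Polynomial.eval_C, rad_sub_norm hw ht.1, norm_pow, Real.norm_eq_abs,
      abs_of_pos ht.1] at ht1
    have : t ^ (k - 1) ≤ t ^ d := pow_le_pow_of_le_one ht.1.le ht.2.le (by omega)
    have h3 : t ^ d * ‖A.eval (rad w t)‖ ≤ t ^ d * c := by nlinarith
    have := le_of_mul_le_mul_left h3 (pow_pos ht.1 d)
    simpa using this
  rw [Asymptotics.isLittleO_one_iff] at h1
  exact hAw (tendsto_nhds_unique (poly_tendsto A w) h1)

theorem a1_mul_littleO (hξ : ∀ j, ‖ξ j‖ = 1) (hm : ∀ j, 0 < m j) (j : Fin n) {k : ℂ → ℂ}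
    (hk : MemH2 k) :
    (fun t => a1fun ξ m (rad (ξ j) t) * k (rad (ξ j) t)) =o[𝓝[>] 0]
      fun t : ℝ => t ^ (m j - 1) * √t := by
  have h1 : (fun t => a1fun ξ m (rad (ξ j) t)) =O[𝓝[>] 0] fun t : ℝ => t ^ m j := by
    have := bigO_of_dvd (hξ j) (P := a1P ξ m) (k := m j)
      (Finset.dvd_prod_of_mem (fun j => (Polynomial.X - Polynomial.C (ξ j)) ^ (m j))
        (Finset.mem_univ j))
    simpa only [a1P_eval] using this
  have h2 : (fun t => k (rad (ξ j) t)) =o[𝓝[>] 0] fun t : ℝ => (√t)⁻¹ := by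
    have h := little_growth hk (hξ j)
    rw [Asymptotics.isLittleO_iff]
    intro c hc
    filter_upwards [h.eventually (gt_mem_nhds hc), self_mem_nhdsWithin] with t ht h0
    have : 0 < √t := Real.sqrt_pos.2 h0
    rw [norm_inv, Real.norm_eq_abs, abs_of_pos this, ← div_eq_mul_inv, le_div_iff₀ this]
    linarith
  refine (h1.mul_isLittleO h2).congr' EventuallyEq.rfl ?_
  filter_upwards [self_mem_nhdsWithin] with t ht
  have ht' : (0:ℝ) < t := ht
  have : 0 < √t := Real.sqrt_pos.2 ht
  have e : t ^ m j = t ^ (m j - 1) * t := by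
    rw [← pow_succ, Nat.sub_add_cancel (hm j)]
  rw [e, ← div_eq_mul_inv, mul_div_assoc, Real.div_sqrt]

theorem sqrt_tendsto : Tendsto (fun t : ℝ => √t) (𝓝[>] 0) (𝓝 0) := by
  have : Continuous fun t : ℝ => √t := by fun_prop
  simpa using (this.tendsto 0).mono_left nhdsWithin_le_nhds

theorem pow_sqrt_littleO (d : ℕ) :
    (fun t : ℝ => t ^ d * √t) =o[𝓝[>] 0] fun t : ℝ => t ^ d := by
  have h := (Asymptotics.isLittleO_one_iff ℝ).2 sqrt_tendsto
  simpa using (Asymptotics.isBigO_refl (fun t : ℝ => t ^ d) (𝓝[>] 0)).mul_isLittleO h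

theorem eq_zero_of_dvd_all (hinj : Function.Injective ξ) {r : Polynomial ℂ}
    (hd : r.degree < ((∑ j, m j : ℕ) : WithBot ℕ))
    (h : ∀ j, (Polynomial.X - Polynomial.C (ξ j)) ^ (m j) ∣ r) : r = 0 := by
  have : a1P ξ m ∣ r := by
    refine Finset.prod_dvd_of_coprime ?_ fun j _ => h j
    intro i _ j _ hij
    exact (Polynomial.pairwise_coprime_X_sub_C hinj hij).pow
  refine Polynomial.eq_zero_of_dvd_of_degree_lt this ?_
  rw [a1P_degree]; exact hd

theorem hb_unique (hξ : ∀ j, ‖ξ j‖ = 1) (hinj : Function.Injective ξ) (hm : ∀ j, 0 < m j)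
    {g : ℂ → ℂ} (hg : MemH2 g) {q : Polynomial ℂ}
    (hd : q.degree < ((∑ j, m j : ℕ) : WithBot ℕ))
    (h : ∀ z ∈ unitDisk, a1fun ξ m z * g z + q.eval z = 0) : q = 0 := by
  refine eq_zero_of_dvd_all hinj hd fun j => dvd_of_littleO (hξ j) (hm j) ?_
  have h1 := (a1_mul_littleO hξ hm j hg).trans (pow_sqrt_littleO (m j - 1))
  refine h1.neg_left.congr' ?_ EventuallyEq.rfl
  filter_upwards [ev_Ioo] with t ht
  have := h _ (rad_mem (hξ j) ht)
  linear_combination -this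

theorem a1_ne_zero (hξ : ∀ j, ‖ξ j‖ = 1) {z : ℂ} (hz : z ∈ unitDisk) : a1fun ξ m z ≠ 0 := by
  rw [a1fun]
  refine Finset.prod_ne_zero_iff.2 fun j _ => pow_ne_zero _ ?_
  intro h
  have := mem_unitDisk_iff.1 hz
  rw [sub_eq_zero.1 h, hξ j] at this
  exact lt_irrefl _ this

theorem poly_eval_fin {N : ℕ} {q : Polynomial ℂ} (hq : q.degree < (N : WithBot ℕ)) (z : ℂ) :
    q.eval z = ∑ i : Fin N, q.coeff i * z ^ (i:ℕ) := by
  rw [← Finset.sum_range (fun i => q.coeff i * z ^ i)]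
  refine (hasSum_poly q z).unique (hasSum_sum_of_ne_finset_zero fun b hb => ?_)
  rw [Polynomial.coeff_eq_zero_of_degree_lt, zero_mul]
  refine hq.trans_le ?_
  simpa using hb

theorem h2NormSq_poly_fin {N : ℕ} {q : Polynomial ℂ} (hq : q.degree < (N : WithBot ℕ)) :
    h2NormSq (fun z => q.eval z) = ∑ i : Fin N, ‖q.coeff i‖ ^ 2 := by
  rw [← Finset.sum_range (fun i => ‖q.coeff i‖ ^ 2), h2NormSq]
  simp only [taylorCoeff_poly]
  refine tsum_eq_sum fun b hb => ?_
  rw [Polynomial.coeff_eq_zero_of_degree_lt]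
  · simp
  refine hq.trans_le ?_
  simpa using hb

/-- Model space for `H(b)`. -/
abbrev hbX (N : ℕ) : Type := ell2 × EuclideanSpace ℂ (Fin N)

/-- Evaluation functional on the model space. -/
def hev (ξ : Fin n → ℂ) (m : Fin n → ℕ) (z : unitDisk) : hbX (∑ j, m j) →L[ℂ] ℂ :=
  a1fun ξ m z • (ev z).comp (ContinuousLinearMap.fst ℂ _ _) +
    (∑ i : Fin (∑ j, m j), ((z:ℂ) ^ (i:ℕ)) • EuclideanSpace.proj i).comp
      (ContinuousLinearMap.snd ℂ _ _)

theorem hev_apply (z : unitDisk) (c : ell2) (v : EuclideanSpace ℂ (Fin (∑ j, m j))) :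
    hev ξ m z (c, v) = a1fun ξ m z * ev z c + ∑ i, v i * (z:ℂ) ^ (i:ℕ) := by
  simp [hev, mul_comm]

/-- Polynomial of a coefficient vector. -/
def polyOf {N : ℕ} (v : EuclideanSpace ℂ (Fin N)) : Polynomial ℂ :=
  ∑ i : Fin N, Polynomial.monomial (i:ℕ) (v i)

theorem polyOf_eval {N : ℕ} (v : EuclideanSpace ℂ (Fin N)) (z : ℂ) :
    (polyOf v).eval z = ∑ i, v i * z ^ (i:ℕ) := by
  simp [polyOf, Polynomial.eval_finsetSum]

theorem polyOf_coeff {N : ℕ} (v : EuclideanSpace ℂ (Fin N)) (i : Fin N) :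
    (polyOf v).coeff i = v i := by
  simp [polyOf, Polynomial.finsetSum_coeff, Polynomial.coeff_monomial, Fin.val_inj]

theorem polyOf_degree {N : ℕ} (v : EuclideanSpace ℂ (Fin N)) :
    (polyOf v).degree < (N : WithBot ℕ) := by
  refine (Polynomial.degree_sum_le _ _).trans_lt ?_
  rw [Finset.sup_lt_iff (WithBot.bot_lt_coe _)]
  intro i _
  refine (Polynomial.degree_monomial_le _ _).trans_lt ?_
  exact_mod_cast i.2

theorem hev_sep (hξ : ∀ j, ‖ξ j‖ = 1) (hinj : Function.Injective ξ) (hm : ∀ j, 0 < m j)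
    (y : hbX (∑ j, m j)) (h : ∀ z, hev ξ m z y = 0) : y = 0 := by
  obtain ⟨c, v⟩ := y
  have hv : polyOf v = 0 := by
    refine hb_unique hξ hinj hm (memH2_fn c) (polyOf_degree v) fun z hz => ?_
    rw [polyOf_eval, fn_eq c ⟨z, hz⟩, ← h ⟨z, hz⟩, hev_apply]
  have hv' : v = 0 := by
    ext i; rw [← polyOf_coeff v i, hv]; simp
  have hc : c = 0 := ev_sep c fun z => by
    have := h z
    rw [hev_apply, hv'] at this
    simpa [a1_ne_zero hξ z.2] using this
  rw [hc, hv']; rfl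

/-- Model vector of a member of `H(b)`. -/
theorem hb_model {f : ℂ → ℂ} (hf : MemHb ξ m f) :
    ∃ x : hbX (∑ j, m j), (∀ z : unitDisk, hev ξ m z x = f z) ∧
      ‖x‖ ^ 2 ≤ hbNormSq ξ m f ∧ hbNormSq ξ m f ≤ 2 * ‖x‖ ^ 2 := by
  have hd : HbDecompOf ξ m f (hbDecomp ξ m f).1 (hbDecomp ξ m f).2 := by
    rw [hbDecomp, dif_pos hf]; exact hf.choose_spec
  obtain ⟨hg, hq, h⟩ := hd
  set g := (hbDecomp ξ m f).1 with hgdef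
  set q := (hbDecomp ξ m f).2 with hqdef
  let v : EuclideanSpace ℂ (Fin (∑ j, m j)) := WithLp.toLp 2 fun i => q.coeff i
  have hv : ‖v‖ ^ 2 = h2NormSq fun z => q.eval z := by
    rw [EuclideanSpace.norm_sq_eq, h2NormSq_poly_fin hq]
  have hb : hbNormSq ξ m f = ‖vec g hg‖ ^ 2 + ‖v‖ ^ 2 := by
    rw [hv, norm_vec]; rfl
  refine ⟨(vec g hg, v), fun z => ?_, ?_, ?_⟩
  · rw [hev_apply, ev_vec, h z z.2, poly_eval_fin hq]
  · rw [hb, Prod.norm_def]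
    rcases max_cases ‖vec g hg‖ ‖v‖ with ⟨e, _⟩ | ⟨e, _⟩ <;>
      simp only [e] <;> nlinarith [sq_nonneg ‖vec g hg‖, sq_nonneg ‖v‖]
  · rw [hb, Prod.norm_def]
    have h1 := le_max_left ‖vec g hg‖ ‖v‖
    have h2 := le_max_right ‖vec g hg‖ ‖v‖
    have h3 := norm_nonneg (vec g hg)
    have h4 := norm_nonneg v
    simp only
    have := pow_le_pow_left₀ h3 h1 2
    have := pow_le_pow_left₀ h4 h2 2
    linarith

theorem comp_iff (hξ : ∀ j, ‖ξ j‖ = 1) (hinj : Function.Injective ξ) (hm : ∀ j, 0 < m j)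
    {φ : ℂ → ℂ} (hφmap : ∀ z ∈ unitDisk, φ z ∈ unitDisk) :
    CompBddHb ξ m φ ↔ ∀ f, MemHb ξ m f → MemHb ξ m fun z => f (φ z) := by
  refine ⟨fun h => h.1, fun h => ⟨h, ?_⟩⟩
  obtain ⟨C, hC0, hC⟩ := abstract_bdd (hev ξ m)
    (fun z => hev ξ m ⟨φ z, hφmap z z.2⟩) (hev_sep hξ hinj hm) (fun x => by
      obtain ⟨c, v⟩ := x
      let f : ℂ → ℂ := fun z => a1fun ξ m z * fn c z + (polyOf v).eval z
      have hf : MemHb ξ m f := ⟨(fn c, polyOf v), memH2_fn c, polyOf_degree v, fun _ _ => rfl⟩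
      obtain ⟨y, hy, -⟩ := hb_model (h f hf)
      refine ⟨y, fun z => ?_⟩
      rw [hy z, hev_apply, ← polyOf_eval, ← fn_eq])
  refine ⟨2 * C ^ 2, fun f hf => ?_⟩
  obtain ⟨x, hx, hx1, -⟩ := hb_model hf
  obtain ⟨y, hy, -, hy2⟩ := hb_model (h f hf)
  have h1 := hC x y fun z => by rw [hy, hx]
  have h2 := pow_le_pow_left₀ (norm_nonneg _) h1 2
  rw [mul_pow] at h2
  have h3 : C ^ 2 * ‖x‖ ^ 2 ≤ C ^ 2 * hbNormSq ξ m f := by gcongr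
  linarith

end HbPart


theorem schwarz_pick {φ : ℂ → ℂ} (hd : DifferentiableOn ℂ φ unitDisk)
    (hφmap : ∀ z ∈ unitDisk, φ z ∈ unitDisk) :
    ∃ c : ℝ, 0 < c ∧ ∀ z ∈ unitDisk, c * (1 - ‖z‖) ≤ 1 - ‖φ z‖ := by
  set α := φ 0 with hα
  have hα1 : ‖α‖ < 1 := mem_unitDisk_iff.1 (hφmap 0 zero_mem_unitDisk)
  have hlow : ∀ w : ℂ, ‖w‖ < 1 → 1 - ‖α‖ ≤ ‖1 - (starRingEnd ℂ) α * w‖ := by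
    intro w hw
    have h1 : ‖(starRingEnd ℂ) α * w‖ ≤ ‖α‖ := by
      rw [norm_mul, RCLike.norm_conj]
      exact mul_le_of_le_one_right (norm_nonneg _) hw.le
    have h2 := norm_sub_norm_le 1 ((starRingEnd ℂ) α * w)
    rw [norm_one] at h2
    linarith
  have hid : ∀ w : ℂ, ‖1 - (starRingEnd ℂ) α * w‖ ^ 2 - ‖w - α‖ ^ 2 =
      (1 - ‖α‖ ^ 2) * (1 - ‖w‖ ^ 2) := by
    intro w
    simp only [← Complex.normSq_eq_norm_sq, Complex.normSq_apply]
    simp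
    ring
  let ψ : ℂ → ℂ := fun z => (φ z - α) / (1 - (starRingEnd ℂ) α * φ z)
  have hne : ∀ z ∈ unitDisk, 0 < ‖1 - (starRingEnd ℂ) α * φ z‖ := fun z hz =>
    lt_of_lt_of_le (by linarith) (hlow _ (mem_unitDisk_iff.1 (hφmap z hz)))
  have hψd : DifferentiableOn ℂ ψ (Metric.ball 0 1) := by
    refine (hd.sub_const α).div ((hd.const_mul _).const_sub 1) fun z hz => ?_
    exact norm_pos_iff.1 (hne z hz)
  have hψm : MapsTo ψ (Metric.ball 0 1) (Metric.closedBall 0 1) := by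
    intro z hz
    rw [mem_closedBall_zero_iff]
    have hw := mem_unitDisk_iff.1 (hφmap z hz)
    simp only [ψ]
    rw [norm_div, div_le_one (hne z hz)]
    have h1 := hid (φ z)
    have h2 : 0 ≤ (1 - ‖α‖ ^ 2) * (1 - ‖φ z‖ ^ 2) := by
      apply mul_nonneg <;> nlinarith [norm_nonneg α, norm_nonneg (φ z)]
    exact (pow_le_pow_iff_left₀ (norm_nonneg _) (norm_nonneg _) two_ne_zero).1 (by linarith)
  refine ⟨(1 - ‖α‖) ^ 2 / 2, by have : 0 < 1 - ‖α‖ := by linarith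
                                positivity, fun z hz => ?_⟩
  have hw := mem_unitDisk_iff.1 (hφmap z hz)
  have hz' := mem_unitDisk_iff.1 hz
  have hs : ‖ψ z‖ ≤ ‖z‖ := Complex.norm_le_norm_of_mapsTo_ball hψd hψm (by simp [ψ, hα]) hz'
  simp only [ψ] at hs
  rw [norm_div, div_le_iff₀ (hne z hz)] at hs
  have h1 := hid (φ z)
  have h3 := hlow _ hw
  set D := ‖1 - (starRingEnd ℂ) α * φ z‖
  have h4 : ‖φ z - α‖ ^ 2 ≤ ‖z‖ ^ 2 * D ^ 2 := by
    rw [← mul_pow]; gcongr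
  have h5 : (1 - ‖z‖ ^ 2) * D ^ 2 ≤ (1 - ‖α‖ ^ 2) * (1 - ‖φ z‖ ^ 2) := by linarith
  have h6 : (1 - ‖α‖) ^ 2 ≤ D ^ 2 := by
    apply pow_le_pow_left₀ _ h3; linarith
  have h7 : (1 - ‖α‖ ^ 2) * (1 - ‖φ z‖ ^ 2) ≤ 1 * (2 * (1 - ‖φ z‖)) := by
    apply mul_le_mul
    · nlinarith [norm_nonneg α]
    · nlinarith [norm_nonneg (φ z)]
    · nlinarith [norm_nonneg (φ z)]
    · norm_num
  have h8 : (1 - ‖z‖) * (1 - ‖α‖) ^ 2 ≤ (1 - ‖z‖ ^ 2) * D ^ 2 := by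
    apply mul_le_mul _ h6 (by positivity)
    · nlinarith [norm_nonneg z]
    · nlinarith [norm_nonneg z]
  linarith

section BackPart

variable {n : ℕ} {ξ : Fin n → ℂ} {m : Fin n → ℕ}

theorem MemHb.add {f g : ℂ → ℂ} (hf : MemHb ξ m f) (hg : MemHb ξ m g) :
    MemHb ξ m fun z => f z + g z := by
  obtain ⟨⟨k, P⟩, hk, -, h⟩ := hf
  obtain ⟨⟨k', P'⟩, hk', -, h'⟩ := hg
  refine memHb_of (k := fun z => k z + k' z) (P := P + P') (hk.add hk') fun z hz => ?_
  rw [h z hz, h' z hz, Polynomial.eval_add]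
  ring

theorem MemHb.mul_bdd {f φ : ℂ → ℂ} (hf : MemHb ξ m f) (hφ : MemHb ξ m φ)
    (hφball : MemBallHinf φ) : MemHb ξ m fun z => φ z * f z := by
  obtain ⟨⟨k, P⟩, hk, -, h⟩ := hf
  obtain ⟨⟨k', P'⟩, hk', -, h'⟩ := hφ
  refine memHb_of (k := fun z => φ z * k z + P.eval z * k' z) (P := P' * P)
    ((hk.bdd_mul hφball.1 hφball.2).add (hk'.poly_mul P)) fun z hz => ?_
  rw [h z hz, Polynomial.eval_mul]
  have := h' z hz
  simp only at this ⊢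
  linear_combination P.eval z * this

theorem memHb_poly_comp {φ : ℂ → ℂ} (hφ : MemHb ξ m φ)
    (hφball : MemBallHinf φ) (Q : Polynomial ℂ) : MemHb ξ m fun z => Q.eval (φ z) := by
  induction Q using Polynomial.induction_on with
  | C a =>
    exact memHb_of (k := fun z => (0 : Polynomial ℂ).eval z) (P := Polynomial.C a)
      (memH2_poly 0) fun z _ => by simp
  | add p q hp hq => simpa using hp.add hq
  | monomial k a h =>
    have := h.mul_bdd hφ hφball
    convert this using 2 with z
    simp
    ring

/-- Division property. -/
def DivProp (B : Polynomial ℂ) : Prop := ∀ g, MemH2 g → ∃ (g₂ : ℂ → ℂ) (s : Polynomial ℂ),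
  MemH2 g₂ ∧ ∀ z ∈ unitDisk, g z = B.eval z * g₂ z + s.eval z

theorem DivProp.mul {B B' : Polynomial ℂ} (h : DivProp B) (h' : DivProp B') :
    DivProp (B * B') := by
  intro g hg
  obtain ⟨g₂, s, hg₂, e⟩ := h g hg
  obtain ⟨g₃, s', hg₃, e'⟩ := h' g₂ hg₂
  refine ⟨g₃, B * s' + s, hg₃, fun z hz => ?_⟩
  rw [e z hz, e' z hz]
  simp
  ring

theorem DivProp.one : DivProp 1 := fun g hg => ⟨g, 0, hg, fun z _ => by simp⟩

theorem DivProp.lin {lam : ℂ} (hl : lam ∈ unitDisk) :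
    DivProp (Polynomial.X - Polynomial.C lam) := by
  intro g hg
  obtain ⟨g₂, h, e⟩ := hg.exists_div hl
  exact ⟨g₂, Polynomial.C (g lam), h, fun z hz => by simpa using e z hz⟩

theorem DivProp.pow {B : Polynomial ℂ} (h : DivProp B) (k : ℕ) : DivProp (B ^ k) := by
  induction k with
  | zero => simpa using DivProp.one
  | succ k ih => rw [pow_succ]; exact ih.mul h

/-- The auxiliary polynomial `B`. -/
def bP (p : ℕ) (m : Fin n → ℕ) (Λ : Fin n → ℂ) : Polynomial ℂ :=
  ∏ j ∈ Finset.univ.filter fun j : Fin n => p ≤ (j : ℕ),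
    (Polynomial.X - Polynomial.C (Λ j)) ^ (m j)

theorem bP_div {p : ℕ} {Λ : Fin n → ℂ} (hΛdisk : ∀ j : Fin n, p ≤ (j : ℕ) → Λ j ∈ unitDisk) :
    DivProp (bP p m Λ) := by
  refine Finset.prod_induction _ DivProp (fun _ _ => DivProp.mul) DivProp.one fun j hj => ?_
  exact (DivProp.lin (hΛdisk j (by simpa using hj))).pow _

theorem ufun_eq (p : ℕ) (Λ : Fin n → ℂ) (φ : ℂ → ℂ) (z : ℂ) :
    ufun p ξ m Λ φ z = a1fun ξ m (φ z) * (bP p m Λ).eval (φ z) / a1fun ξ m z := by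
  simp [ufun, bP, Polynomial.eval_prod]

theorem backward (hξ : ∀ j, ‖ξ j‖ = 1) {φ : ℂ → ℂ} (hφb : MemHb ξ m φ)
    (hφball : MemBallHinf φ) (hφmap : ∀ z ∈ unitDisk, φ z ∈ unitDisk) {p : ℕ} {Λ : Fin n → ℂ}
    (hΛdisk : ∀ j : Fin n, p ≤ (j : ℕ) → Λ j ∈ unitDisk)
    (hW : ∀ f, MemH2 f → MemH2 fun z => ufun p ξ m Λ φ z * f (φ z)) (f : ℂ → ℂ)
    (hf : MemHb ξ m f) : MemHb ξ m fun z => f (φ z) := by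
  obtain ⟨⟨g, q⟩, hg, -, h⟩ := hf
  obtain ⟨g₂, s, hg₂, e⟩ := bP_div (m := m) hΛdisk g hg
  have h1 : MemHb ξ m fun z => a1fun ξ m z * (ufun p ξ m Λ φ z * g₂ (φ z)) :=
    memHb_of (P := 0) (hW g₂ hg₂) fun z _ => by simp
  have h2 := h1.add (memHb_poly_comp hφb hφball (a1P ξ m * s + q))
  obtain ⟨⟨k, P⟩, hk, -, h'⟩ := h2
  refine memHb_of (P := P) hk fun z hz => ?_
  rw [← h' z hz, h _ (hφmap z hz)]
  simp only
  rw [e _ (hφmap z hz), ufun_eq]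
  have := a1_ne_zero (m := m) hξ hz
  simp only [Polynomial.eval_add, Polynomial.eval_mul, a1P_eval]
  field_simp
  ring

end BackPart


section ForwPart

open scoped Asymptotics Topology

variable {n : ℕ} {ξ : Fin n → ℂ} {m : Fin n → ℕ}

theorem NTLimit.radial {φ : ℂ → ℂ} {w L : ℂ} (hw : ‖w‖ = 1) (h : NTLimit φ w L) :
    Tendsto (fun t => φ (rad w t)) (𝓝[>] 0) (𝓝 L) := by
  refine (h 2 (by norm_num)).comp (tendsto_nhdsWithin_iff.2 ⟨rad_tendsto w, ?_⟩)
  filter_upwards [ev_Ioo] with t ht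
  refine ⟨rad_mem hw ht, ?_⟩
  rw [rad_sub_norm hw ht.1, rad_norm hw ht]
  linarith [ht.1]

theorem t_littleO_sqrt : (fun t : ℝ => t) =o[𝓝[>] 0] fun t : ℝ => √t := by
  have h := (Asymptotics.isLittleO_one_iff ℝ).2 sqrt_tendsto
  have h2 := (Asymptotics.isBigO_refl (fun t : ℝ => √t) (𝓝[>] 0)).mul_isLittleO h
  refine h2.congr' ?_ ?_
  · filter_upwards [self_mem_nhdsWithin] with t ht
    exact Real.mul_self_sqrt (le_of_lt ht)
  · filter_upwards with t; simp

theorem pow_bigO_pow {d e : ℕ} (h : e ≤ d) :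
    (fun t : ℝ => t ^ d) =O[𝓝[>] 0] fun t : ℝ => t ^ e := by
  refine Asymptotics.IsBigO.of_bound 1 ?_
  filter_upwards [ev_Ioo] with t ht
  rw [one_mul, Real.norm_eq_abs, Real.norm_eq_abs, abs_of_pos (pow_pos ht.1 _),
    abs_of_pos (pow_pos ht.1 _)]
  exact pow_le_pow_of_le_one ht.1.le ht.2.le h

theorem pow_littleO_pow {d e : ℕ} (h : e < d) :
    (fun t : ℝ => t ^ d) =o[𝓝[>] 0] fun t : ℝ => t ^ e := by
  have h1 : (fun t : ℝ => t) =o[𝓝[>] 0] fun _ : ℝ => (1:ℝ) := by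
    rw [Asymptotics.isLittleO_one_iff]
    exact tendsto_id.mono_left nhdsWithin_le_nhds
  have h2 := (Asymptotics.isBigO_refl (fun t : ℝ => t ^ e) (𝓝[>] 0)).mul_isLittleO h1
  refine (pow_bigO_pow (Nat.succ_le_of_lt h)).trans_isLittleO ?_
  simpa [pow_succ] using h2

theorem phi_decomp (hξ : ∀ j, ‖ξ j‖ = 1) (hm : ∀ j, 0 < m j) {φ : ℂ → ℂ} (hφb : MemHb ξ m φ)
    {j : Fin n} {L : ℂ} (hL : Tendsto (fun t => φ (rad (ξ j) t)) (𝓝[>] 0) (𝓝 L)) :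
    ∃ A B : ℝ → ℂ, A =o[𝓝[>] 0] (fun t : ℝ => t ^ (m j - 1) * √t) ∧
      B =O[𝓝[>] 0] (fun t : ℝ => t) ∧ ∀ᶠ t in 𝓝[>] 0, φ (rad (ξ j) t) - L = A t + B t := by
  obtain ⟨⟨h, q⟩, hh, -, e⟩ := hφb
  simp only at hh e
  have hA := a1_mul_littleO hξ hm j hh
  have hA0 : Tendsto (fun t => a1fun ξ m (rad (ξ j) t) * h (rad (ξ j) t)) (𝓝[>] 0) (𝓝 0) := by
    rw [← Asymptotics.isLittleO_one_iff ℝ]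
    have := pow_bigO_pow (Nat.zero_le (m j - 1))
    simp only [pow_zero] at this
    exact (hA.trans (pow_sqrt_littleO _)).trans_isBigO this
  have hq : q.eval (ξ j) = L := by
    refine tendsto_nhds_unique (poly_tendsto q (ξ j)) ?_
    have := hL.sub hA0
    rw [sub_zero] at this
    refine this.congr' ?_
    filter_upwards [ev_Ioo] with t ht
    rw [e _ (rad_mem (hξ j) ht)]
    ring
  have hB := bigO_of_dvd (hξ j) (P := q - Polynomial.C L) (k := 1) (by
    rw [pow_one, Polynomial.dvd_iff_isRoot]
    simp [hq])
  simp only [pow_one] at hB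
  refine ⟨_, _, hA, hB, ?_⟩
  filter_upwards [ev_Ioo] with t ht
  rw [e _ (rad_mem (hξ j) ht)]
  simp
  ring

theorem phi_littleO (hξ : ∀ j, ‖ξ j‖ = 1) (hm : ∀ j, 0 < m j) {φ : ℂ → ℂ} (hφb : MemHb ξ m φ)
    {j : Fin n} {L : ℂ} (hL : Tendsto (fun t => φ (rad (ξ j) t)) (𝓝[>] 0) (𝓝 L)) :
    (fun t => φ (rad (ξ j) t) - L) =o[𝓝[>] 0] fun t : ℝ => √t := by
  obtain ⟨A, B, hA, hB, e⟩ := phi_decomp hξ hm hφb hL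
  have h1 : (fun t : ℝ => t ^ (m j - 1) * √t) =O[𝓝[>] 0] fun t : ℝ => √t := by
    simpa using (pow_bigO_pow (Nat.zero_le (m j - 1))).mul
      (Asymptotics.isBigO_refl (fun t : ℝ => √t) (𝓝[>] 0))
  have := (hA.trans_isBigO h1).add (hB.trans_isLittleO t_littleO_sqrt)
  refine this.congr' ?_ EventuallyEq.rfl
  filter_upwards [e] with t ht using ht.symm

theorem phi_bigO (hξ : ∀ j, ‖ξ j‖ = 1) (hm : ∀ j, 0 < m j) {φ : ℂ → ℂ} (hφb : MemHb ξ m φ)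
    {j : Fin n} {L : ℂ} (hL : Tendsto (fun t => φ (rad (ξ j) t)) (𝓝[>] 0) (𝓝 L))
    (h2 : 2 ≤ m j) :
    (fun t => φ (rad (ξ j) t) - L) =O[𝓝[>] 0] fun t : ℝ => t := by
  obtain ⟨A, B, hA, hB, e⟩ := phi_decomp hξ hm hφb hL
  have h1 : (fun t : ℝ => t ^ (m j - 1) * √t) =O[𝓝[>] 0] fun t : ℝ => t := by
    have := (pow_sqrt_littleO (m j - 1)).isBigO.trans
      (pow_bigO_pow (show 1 ≤ m j - 1 by omega))
    simpa using this
  have := (hA.isBigO.trans h1).add hB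
  refine this.congr' ?_ EventuallyEq.rfl
  filter_upwards [e] with t ht using ht.symm

theorem poly_phi_bigO {φ : ℂ → ℂ} (hφmap : ∀ z ∈ unitDisk, φ z ∈ unitDisk) (P : Polynomial ℂ)
    {w : ℂ} (hw : ‖w‖ = 1) :
    (fun t => P.eval (φ (rad w t))) =O[𝓝[>] 0] fun _ : ℝ => (1:ℝ) := by
  obtain ⟨A, hA⟩ := poly_bdd P
  refine Asymptotics.IsBigO.of_bound A ?_
  filter_upwards [ev_Ioo] with t ht
  simpa using hA _ (mem_unitDisk_iff.1 (hφmap _ (rad_mem hw ht))).le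

theorem h2_phi_bigO {φ : ℂ → ℂ} (hd : DifferentiableOn ℂ φ unitDisk)
    (hφmap : ∀ z ∈ unitDisk, φ z ∈ unitDisk) {g : ℂ → ℂ} (hg : MemH2 g)
    {w : ℂ} (hw : ‖w‖ = 1) :
    (fun t => g (φ (rad w t))) =O[𝓝[>] 0] fun t : ℝ => (√t)⁻¹ := by
  obtain ⟨c, hc, h⟩ := schwarz_pick hd hφmap
  refine Asymptotics.IsBigO.of_bound (√(h2NormSq g) / √c) ?_
  filter_upwards [ev_Ioo] with t ht
  have h1 := growth_sqrt hg (hφmap _ (rad_mem hw ht))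
  have h2 := h _ (rad_mem hw ht)
  rw [rad_norm hw ht, sub_sub_cancel] at h2
  have h3 : √c * √t ≤ √(1 - ‖φ (rad w t)‖) := by
    rw [← Real.sqrt_mul hc.le]; exact Real.sqrt_le_sqrt h2
  have hc' : 0 < √c := Real.sqrt_pos.2 hc
  have ht' : 0 < √t := Real.sqrt_pos.2 ht.1
  rw [norm_inv, Real.norm_eq_abs, abs_of_pos ht', ← div_eq_mul_inv, div_div,
    le_div_iff₀ (by positivity)]
  refine le_trans ?_ h1
  gcongr

/-- The cofactor of `a₁` at `ξ l`. -/
theorem a1P_factor (hinj : Function.Injective ξ) (l : Fin n) :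
    ∃ A : Polynomial ℂ, a1P ξ m = (Polynomial.X - Polynomial.C (ξ l)) ^ (m l) * A ∧
      A.eval (ξ l) ≠ 0 := by
  refine ⟨∏ j ∈ Finset.univ.erase l, (Polynomial.X - Polynomial.C (ξ j)) ^ (m j), ?_, ?_⟩
  · rw [a1P, Finset.mul_prod_erase _ (fun j => (Polynomial.X - Polynomial.C (ξ j)) ^ (m j))
      (Finset.mem_univ l)]
  · rw [Polynomial.eval_prod]
    refine Finset.prod_ne_zero_iff.2 fun j hj => ?_
    simp only [Polynomial.eval_pow, Polynomial.eval_sub, Polynomial.eval_X, Polynomial.eval_C]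
    refine pow_ne_zero _ (sub_ne_zero.2 fun h => ?_)
    exact (Finset.mem_erase.1 hj).1 (hinj h).symm

theorem pow_mul_inv_sqrt {d : ℕ} (hd : 0 < d) :
    (fun t : ℝ => t ^ d * (√t)⁻¹) =ᶠ[𝓝[>] 0] fun t : ℝ => t ^ (d - 1) * √t := by
  filter_upwards [self_mem_nhdsWithin] with t ht
  have e : t ^ d = t ^ (d - 1) * t := by
    rw [← pow_succ, Nat.sub_add_cancel hd]
  rw [e, ← div_eq_mul_inv, mul_div_assoc, Real.div_sqrt]

theorem memH2_log {w : ℂ} (hw : ‖w‖ = 1) :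
    MemH2 fun z => -Complex.log (1 - (starRingEnd ℂ) w * z) := by
  refine memH2_of_hasSum (c := fun k => ((starRingEnd ℂ) w) ^ k / k) ?_ ?_
  · intro z hz
    have hlt : ‖(starRingEnd ℂ) w * z‖ < 1 := by
      rw [norm_mul, RCLike.norm_conj, hw, one_mul]; exact mem_unitDisk_iff.1 hz
    have := Complex.hasSum_taylorSeries_neg_log hlt
    have he : (fun k : ℕ => ((starRingEnd ℂ) w) ^ k / k * z ^ k) =
        fun k : ℕ => ((starRingEnd ℂ) w * z) ^ k / k := by
      funext k; rw [mul_pow]; ring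
    rw [he]; exact this
  · have : Summable fun k : ℕ => (1:ℝ) / (k:ℝ) ^ 2 := Real.summable_one_div_nat_pow.2 (by norm_num)
    refine this.congr fun k => ?_
    simp [hw]

theorem log_case (hξ : ∀ j, ‖ξ j‖ = 1) (hinj : Function.Injective ξ) (hm : ∀ j, 0 < m j)
    {φ : ℂ → ℂ} (hφb : MemHb ξ m φ) (hd : DifferentiableOn ℂ φ unitDisk)
    (hφmap : ∀ z ∈ unitDisk, φ z ∈ unitDisk) {j l : Fin n}
    (hL : Tendsto (fun t => φ (rad (ξ j) t)) (𝓝[>] 0) (𝓝 (ξ l)))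
    (hC : ∀ f, MemHb ξ m f → MemHb ξ m fun z => f (φ z)) (h2 : 2 ≤ m j) : m j ≤ m l := by
  by_contra hlt
  rw [not_le] at hlt
  have hgH := memH2_log (hξ l)
  set g : ℂ → ℂ := fun z => -Complex.log (1 - (starRingEnd ℂ) (ξ l) * z) with hgdef
  obtain ⟨⟨k, r⟩, hk, -, e⟩ := hC (fun z => a1fun ξ m z * g z)
    (memHb_of (P := 0) hgH fun z _ => by simp)
  simp only at hk e
  obtain ⟨A, hA, hA0⟩ := a1P_factor (m := m) hinj l
  have hφO := phi_bigO hξ hm hφb hL h2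
  have hX : ∀ t, a1fun ξ m (φ (rad (ξ j) t)) =
      (φ (rad (ξ j) t) - ξ l) ^ m l * A.eval (φ (rad (ξ j) t)) := by
    intro t; rw [← a1P_eval, hA]; simp
  have hXO : (fun t => a1fun ξ m (φ (rad (ξ j) t))) =O[𝓝[>] 0] fun t : ℝ => t ^ m l := by
    have := (hφO.pow (m l)).mul (poly_phi_bigO hφmap A (hξ j))
    simp only [mul_one] at this
    simpa only [hX] using this
  have hXlow : (fun t : ℝ => t ^ m l) =O[𝓝[>] 0] fun t => a1fun ξ m (φ (rad (ξ j) t)) := by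
    obtain ⟨c, hc, h⟩ := schwarz_pick hd hφmap
    have h1 : (fun t : ℝ => t) =O[𝓝[>] 0] fun t => φ (rad (ξ j) t) - ξ l := by
      refine Asymptotics.IsBigO.of_bound c⁻¹ ?_
      filter_upwards [ev_Ioo] with t ht
      have h3 := h _ (rad_mem (hξ j) ht)
      rw [rad_norm (hξ j) ht, sub_sub_cancel] at h3
      have h4 := norm_sub_norm_le (ξ l) (φ (rad (ξ j) t))
      rw [hξ l, norm_sub_rev] at h4
      rw [Real.norm_eq_abs, abs_of_pos ht.1, inv_mul_eq_div, le_div_iff₀ hc]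
      linarith
    have h5 : (fun _ : ℝ => (1:ℝ)) =O[𝓝[>] 0] fun t => A.eval (φ (rad (ξ j) t)) := by
      have ht : Tendsto (fun t => A.eval (φ (rad (ξ j) t))) (𝓝[>] 0) (𝓝 (A.eval (ξ l))) :=
        (A.continuous.tendsto _).comp hL
      have hn := ht.norm.eventually (lt_mem_nhds
        (show ‖A.eval (ξ l)‖ / 2 < ‖A.eval (ξ l)‖ by
          have := norm_pos_iff.2 hA0; linarith))
      refine Asymptotics.IsBigO.of_bound (‖A.eval (ξ l)‖ / 2)⁻¹ ?_
      filter_upwards [hn] with t ht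
      have := norm_pos_iff.2 hA0
      rw [norm_one, inv_mul_eq_div, le_div_iff₀ (by positivity)]
      linarith
    have := (h1.pow (m l)).mul h5
    simp only [mul_one] at this
    simpa only [hX] using this
  have hXg : (fun t => a1fun ξ m (φ (rad (ξ j) t)) * g (φ (rad (ξ j) t))) =o[𝓝[>] 0]
      fun t : ℝ => t ^ (m l - 1) := by
    have h1 := hXO.mul (h2_phi_bigO hd hφmap hgH (hξ j))
    exact (h1.trans_eventuallyEq (pow_mul_inv_sqrt (hm l))).trans_isLittleO (pow_sqrt_littleO _)
  have hak := (a1_mul_littleO hξ hm j hk).trans (pow_sqrt_littleO _)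
  have hak1 := hak.trans_isBigO (pow_bigO_pow (show m l ≤ m j - 1 by omega))
  have hr : (fun t => r.eval (rad (ξ j) t)) =o[𝓝[>] 0] fun t : ℝ => t ^ (m l - 1) := by
    have := hXg.sub (hak1.trans_isBigO (pow_bigO_pow (show m l - 1 ≤ m l by omega)))
    refine this.congr' ?_ EventuallyEq.rfl
    filter_upwards [ev_Ioo] with t ht
    rw [e _ (rad_mem (hξ j) ht)]; ring
  have hr2 := bigO_of_dvd (hξ j) (dvd_of_littleO (hξ j) (hm l) hr)
  have hXg2 : (fun t => a1fun ξ m (φ (rad (ξ j) t)) * g (φ (rad (ξ j) t))) =O[𝓝[>] 0]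
      fun t => a1fun ξ m (φ (rad (ξ j) t)) := by
    refine Asymptotics.IsBigO.trans ?_ hXlow
    refine (hak1.isBigO.add hr2).congr' ?_ EventuallyEq.rfl
    filter_upwards [ev_Ioo] with t ht
    rw [e _ (rad_mem (hξ j) ht)]
  obtain ⟨C, hCb⟩ := hXg2.bound
  have hlim : Tendsto (fun t => ‖1 - (starRingEnd ℂ) (ξ l) * φ (rad (ξ j) t)‖) (𝓝[>] 0)
      (𝓝[>] 0) := by
    rw [tendsto_nhdsWithin_iff]
    constructor
    · have := ((hL.const_mul ((starRingEnd ℂ) (ξ l))).const_sub 1).norm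
      rw [← Complex.normSq_eq_conj_mul_self, Complex.normSq_eq_norm_sq, hξ l] at this
      simpa using this
    · filter_upwards [ev_Ioo] with t ht
      rw [Set.mem_Ioi, norm_pos_iff, sub_ne_zero]
      intro h
      have h3 := congrArg norm h
      rw [norm_one, norm_mul, RCLike.norm_conj, hξ l, one_mul] at h3
      have := mem_unitDisk_iff.1 (hφmap _ (rad_mem (hξ j) ht))
      linarith
  have hbot := Real.tendsto_log_nhdsGT_zero.comp hlim
  obtain ⟨t, ⟨h3, h4⟩, ht⟩ :=
    (((hbot.eventually (eventually_lt_atBot (-|C|))).and hCb).and ev_Ioo).exists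
  have hne : 0 < ‖a1fun ξ m (φ (rad (ξ j) t))‖ :=
    norm_pos_iff.2 (a1_ne_zero hξ (hφmap _ (rad_mem (hξ j) ht)))
  rw [norm_mul, mul_comm] at h4
  have h5 := le_of_mul_le_mul_right h4 hne
  have h6 : |Real.log ‖1 - (starRingEnd ℂ) (ξ l) * φ (rad (ξ j) t)‖| ≤
      ‖g (φ (rad (ξ j) t))‖ := by
    rw [hgdef, norm_neg, ← Complex.log_re]
    exact Complex.abs_re_le_norm _
  have h7 := neg_le_abs (Real.log ‖1 - (starRingEnd ℂ) (ξ l) * φ (rad (ξ j) t)‖)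
  have h8 := le_abs_self C
  simp only [Function.comp] at h3
  linarith

theorem forward (hξ : ∀ j, ‖ξ j‖ = 1) (hinj : Function.Injective ξ) (hm : ∀ j, 0 < m j)
    {φ : ℂ → ℂ} (hφb : MemHb ξ m φ) (hd : DifferentiableOn ℂ φ unitDisk)
    (hφmap : ∀ z ∈ unitDisk, φ z ∈ unitDisk) {p : ℕ} {Λ : Fin n → ℂ}
    (hΛ : ∀ j, NTLimit φ (ξ j) (Λ j))
    (hΛcirc : ∀ j : Fin n, (j : ℕ) < p → ∃ i, Λ j = ξ i)
    (hΛdisk : ∀ j : Fin n, p ≤ (j : ℕ) → Λ j ∈ unitDisk)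
    (hC : ∀ f, MemHb ξ m f → MemHb ξ m fun z => f (φ z)) (g : ℂ → ℂ) (hg : MemH2 g) :
    MemH2 fun z => ufun p ξ m Λ φ z * g (φ z) := by
  obtain ⟨⟨k, r⟩, hk, hr, e⟩ := hC (fun z => a1fun ξ m z * ((bP p m Λ).eval z * g z))
    (memHb_of (P := 0) (hg.poly_mul (bP p m Λ)) fun z _ => by simp)
  simp only at hk hr e
  have hr0 : r = 0 := by
    refine eq_zero_of_dvd_all hinj hr fun j => dvd_of_littleO (hξ j) (hm j) ?_
    have hL := (hΛ j).radial (hξ j)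
    have hak := (a1_mul_littleO hξ hm j hk).trans (pow_sqrt_littleO _)
    suffices hF : (fun t => a1fun ξ m (φ (rad (ξ j) t)) *
        ((bP p m Λ).eval (φ (rad (ξ j) t)) * g (φ (rad (ξ j) t)))) =o[𝓝[>] 0]
        fun t : ℝ => t ^ (m j - 1) by
      refine (hF.sub hak).congr' ?_ EventuallyEq.rfl
      filter_upwards [ev_Ioo] with t ht
      rw [e _ (rad_mem (hξ j) ht)]; ring
    have hBO := poly_phi_bigO hφmap (bP p m Λ) (hξ j)
    by_cases hj : (j:ℕ) < p
    · obtain ⟨l, hl⟩ := hΛcirc j hj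
      rw [hl] at hL
      obtain ⟨A, hA, -⟩ := a1P_factor (m := m) hinj l
      have hX : ∀ t, a1fun ξ m (φ (rad (ξ j) t)) =
          (φ (rad (ξ j) t) - ξ l) ^ m l * A.eval (φ (rad (ξ j) t)) := by
        intro t; rw [← a1P_eval, hA]; simp
      have hAO := poly_phi_bigO hφmap A (hξ j)
      have hBg := hBO.mul (h2_phi_bigO hd hφmap hg (hξ j))
      simp only [one_mul] at hBg
      by_cases h2 : 2 ≤ m j
      · have hle := log_case hξ hinj hm hφb hd hφmap hL hC h2
        have h1 := ((phi_bigO hξ hm hφb hL h2).pow (m l)).mul hAO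
        simp only [mul_one] at h1
        have h3 := (h1.trans (pow_bigO_pow hle)).mul hBg
        simp only [hX]
        exact (h3.trans_eventuallyEq (pow_mul_inv_sqrt (hm j))).trans_isLittleO
          (pow_sqrt_littleO _)
      · have h1m : m j - 1 = 0 := by omega
        have h1 := phi_littleO hξ hm hφb hL
        have h3 : (fun t => (φ (rad (ξ j) t) - ξ l) ^ (m l - 1)) =O[𝓝[>] 0]
            fun _ : ℝ => (1:ℝ) := by
          have := poly_phi_bigO hφmap ((Polynomial.X - Polynomial.C (ξ l)) ^ (m l - 1)) (hξ j)
          simpa using this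
        have h4 := ((h1.mul_isBigO h3).mul_isBigO hAO).mul_isBigO hBg
        rw [h1m]
        refine h4.congr' ?_ ?_
        · filter_upwards with t
          rw [hX, ← pow_succ', Nat.sub_add_cancel (hm l)]
        · filter_upwards [self_mem_nhdsWithin] with t ht
          have : √t ≠ 0 := (Real.sqrt_pos.2 ht).ne'
          simp [this]
    · rw [not_lt] at hj
      have hgO : (fun t => g (φ (rad (ξ j) t))) =O[𝓝[>] 0] fun _ : ℝ => (1:ℝ) := by
        have hc : ContinuousAt g (Λ j) :=
          hg.1.continuousOn.continuousAt (Metric.isOpen_ball.mem_nhds (hΛdisk j hj))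
        exact (hc.tendsto.comp hL).isBigO_one ℝ
      have haO := poly_phi_bigO hφmap (a1P ξ m) (hξ j)
      simp only [a1P_eval] at haO
      obtain ⟨B', hB'⟩ : (Polynomial.X - Polynomial.C (Λ j)) ^ (m j) ∣ bP p m Λ :=
        Finset.dvd_prod_of_mem (fun j => (Polynomial.X - Polynomial.C (Λ j)) ^ (m j))
          (by simpa using hj)
      have hB'O := poly_phi_bigO hφmap B' (hξ j)
      have key : (fun t => (φ (rad (ξ j) t) - Λ j) ^ m j) =o[𝓝[>] 0]
          fun t : ℝ => t ^ (m j - 1) := by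
        by_cases h2 : 2 ≤ m j
        · exact ((phi_bigO hξ hm hφb hL h2).pow (m j)).trans_isLittleO
            (pow_littleO_pow (by omega))
        · have h1m : m j = 1 := by have := hm j; omega
          rw [h1m]
          simp only [pow_one, Nat.sub_self, pow_zero]
          rw [Asymptotics.isLittleO_one_iff]
          simpa using hL.sub_const (Λ j)
      have := haO.mul_isLittleO ((key.mul_isBigO hB'O).mul_isBigO hgO)
      simp only [one_mul, mul_one] at this
      simpa [hB'] using this
  refine hk.congr fun z hz => ?_
  have h1 := e z hz
  rw [hr0, Polynomial.eval_zero, add_zero] at h1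
  have := a1_ne_zero (m := m) hξ hz
  rw [ufun_eq]
  field_simp
  linear_combination h1

end ForwPart

/-- Theorem 4.1. `C_φ` is bounded on `H(b)` if and only if the weighted
composition operator `W_{u,φ}` is bounded on `H²`. -/
theorem comp_bounded_iff_weighted_comp_bounded
    (b a : ℂ → ℂ) (n : ℕ) (ξ : Fin n → ℂ) (m : Fin n → ℕ)
    (hset : RationalSetting b a n ξ m)
    (φ : ℂ → ℂ) (hφb : MemHb ξ m φ) (hφball : MemBallHinf φ)
    (hφmap : ∀ z ∈ unitDisk, φ z ∈ unitDisk)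
    (Λ : Fin n → ℂ) (hΛ : ∀ j, NTLimit φ (ξ j) (Λ j))
    (p : ℕ) (hp : p ≤ n)
    (hΛcirc : ∀ j : Fin n, (j : ℕ) < p → ∃ i, Λ j = ξ i)
    (hΛdisk : ∀ j : Fin n, p ≤ (j : ℕ) → Λ j ∈ unitDisk) :
    CompBddHb ξ m φ ↔ WCompBddH2 (ufun p ξ m Λ φ) φ := by
  have hξ : ∀ j, ‖ξ j‖ = 1 := fun j => by simpa [unitCircle] using hset.zeros_mem j
  rw [comp_iff hξ hset.zeros_inj hset.mult_pos hφmap, wcomp_iff hφmap]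
  exact ⟨fun hC => forward hξ hset.zeros_inj hset.mult_pos hφb hφball.1 hφmap hΛ hΛcirc hΛdisk hC,
    fun hW => backward hξ hφb hφball hφmap hΛdisk hW⟩

end
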